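/- Let n ≥ 1 and r_1,…,r_n ∈ ℚ∩(0,1). Then χ(a) = π(t_n s_n^∞) for every a ∈ [π(s_n^∞), π(s_n t_n s_n^∞)]; moreover χ(a) < π(t_n s_n^∞) for every a ∈ (1/4, π(s_n^∞)) and χ(a) > π(t_n s_n^∞) for every a ∈ (π(s_n t_n s_n^∞), 1/2), so this interval is an actual plateau of χ. -/

import Mathlib

noncomputable section

/-- The doubling map. -/
def Dbl (x : ℝ) : ℝ := if x ≤ 1/2 then 2*x else 2*x - 1

/-- Survivor set `𝒥(a,b)`. -/
def J (a b : ℝ) : Set ℝ := {x ∈ Set.Icc (0:ℝ) 1 | ∀ n : ℕ, Dbl^[n] x ∉ Set.Ioo a b}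

/-- The shift on binary sequences. -/
def shft (x : ℕ → Bool) : ℕ → Bool := fun n => x (n+1)

/-- Binary expansion value. -/
def piMap (w : ℕ → Bool) : ℝ := ∑' n : ℕ, (if w n then (1:ℝ) else 0) / 2 ^ (n+1)

/-- Strict lexicographic order on binary sequences. -/
def seqLt (u v : ℕ → Bool) : Prop := ∃ n, (∀ i < n, u i = v i) ∧ u n < v n

def seqLe (u v : ℕ → Bool) : Prop := seqLt u v ∨ u = v

/-- Periodic sequence `w^∞` associated with a finite word. -/
def per (w : List Bool) : ℕ → Bool := fun n => w.getD (n % w.length) false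

/-- Concatenation of a finite word and an infinite sequence. -/
def cat (w : List Bool) (x : ℕ → Bool) : ℕ → Bool :=
  fun n => if n < w.length then w.getD n false else x (n - w.length)

/-- A finite word is balanced. -/
def BalancedWord (l : List Bool) : Prop :=
  ∀ u v : List Bool, u <:+: l → v <:+: l → u.length = v.length →
    (u.count true : ℤ) - (v.count true : ℤ) ≤ 1

/-- A finite word is cyclically balanced. -/
def CycBalanced (w : List Bool) : Prop := BalancedWord (w ++ w)

def OmegaSet (r : ℚ) (b : Bool) : Set (List Bool) :=
  {w | w.length = r.den ∧ w.count true = r.num.toNat ∧ CycBalanced w ∧ w.head? = some b}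

/-- `w` is the lexicographically largest cyclically balanced word of length `q`
with `p` ones beginning with 0, where `r = p/q` in lowest terms. -/
def IsOmegaMinus (r : ℚ) (w : List Bool) : Prop :=
  w ∈ OmegaSet r false ∧ ∀ v ∈ OmegaSet r false, v = w ∨ List.Lex (· < ·) v w

/-- `w` is the lexicographically smallest cyclically balanced word of length `q`
with `p` ones beginning with 1. -/
def IsOmegaPlus (r : ℚ) (w : List Bool) : Prop :=
  w ∈ OmegaSet r true ∧ ∀ v ∈ OmegaSet r true, v = w ∨ List.Lex (· < ·) w v

open Classical in
def omegaMinus (r : ℚ) : List Bool :=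
  if h : ∃ w, IsOmegaMinus r w then h.choose else []

open Classical in
def omegaPlus (r : ℚ) : List Bool :=
  if h : ∃ w, IsOmegaPlus r w then h.choose else []

/-- The substitution `ρ_r` applied to a word. -/
def substR (r : ℚ) (w : List Bool) : List Bool :=
  (w.map (fun b => if b then omegaPlus r else omegaMinus r)).flatten

/-- `s_n = ρ_{r_1}∘⋯∘ρ_{r_n}(0)`. -/
def sWord : List ℚ → List Bool
  | [] => [false]
  | r :: rs => substR r (sWord rs)

/-- `t_n = ρ_{r_1}∘⋯∘ρ_{r_n}(1)`. -/
def tWord : List ℚ → List Bool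
  | [] => [true]
  | r :: rs => substR r (tWord rs)

/-- `Δ(r_1,…,r_n) = [π(s_n^∞), π(s_n t_n^∞)]`. -/
def DeltaI (rs : List ℚ) : Set ℝ :=
  Set.Icc (piMap (per (sWord rs))) (piMap (cat (sWord rs) (per (tWord rs))))

/-- `Δ̃(r_1,…,r_n) = [π(s_n t_n s_n^∞), π(s_n t_n^∞)]`. -/
def DeltaTilde (rs : List ℚ) : Set ℝ :=
  Set.Icc (piMap (cat (sWord rs) (cat (tWord rs) (per (sWord rs)))))
    (piMap (cat (sWord rs) (per (tWord rs))))

/-- The exceptional set `𝒮`. -/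
def Scal : Set ℝ :=
  Set.Ioo (1/4 : ℝ) (1/2) \ ⋃ r ∈ {r : ℚ | 0 < r ∧ r < 1}, DeltaI [r]

/-- `φ(a)`. -/
def phi (a : ℝ) : ℝ := sSup {b | b ∈ Set.Ioo a 1 ∧ J a b ≠ ({0, 1} : Set ℝ)}

/-- `χ(a)`. -/
def chi (a : ℝ) : ℝ := sSup {b | b ∈ Set.Ioo a 1 ∧ ¬ (J a b).Countable}

/-- `s_n` built from the first `m` entries of an infinite sequence of rationals. -/
def sWordN (r : ℕ → ℚ) (m : ℕ) : List Bool := sWord (List.ofFn fun i : Fin m => r i)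

def tWordN (r : ℕ → ℚ) (m : ℕ) : List Bool := tWord (List.ofFn fun i : Fin m => r i)

/-- `𝔰(𝐫)`, the coordinatewise limit of `ρ_{r_1}⋯ρ_{r_n}(0)`. -/
def sLim (r : ℕ → ℚ) : ℕ → Bool := fun k => (sWordN r (k+1)).getD k false

/-- `𝔱(𝐫)`. -/
def tLim (r : ℕ → ℚ) : ℕ → Bool := fun k => (tWordN r (k+1)).getD k false

/-! ### Sequences, lexicographic order, binary values -/

/-- Prepend a letter. -/
def cns (b : Bool) (x : ℕ → Bool) : ℕ → Bool
  | 0 => b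
  | n + 1 => x n

/-- The constant sequence. -/
def cst (b : Bool) : ℕ → Bool := fun _ => b

theorem bool_not_lt_false {b : Bool} (h : b < false) : False := by
  cases b <;> exact absurd h (by decide)

theorem bool_not_true_lt {b : Bool} (h : true < b) : False := by
  cases b <;> exact absurd h (by decide)

theorem cns_eta (x : ℕ → Bool) : cns (x 0) (shft x) = x := by
  funext n; cases n <;> rfl

theorem shft_cns (b : Bool) (x : ℕ → Bool) : shft (cns b x) = x := rfl

theorem cns_zero (b : Bool) (x : ℕ → Bool) : cns b x 0 = b := rfl

theorem cst_eq (b : Bool) : cst b = cns b (cst b) := by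
  funext n; cases n <;> rfl

theorem cns_inj {b : Bool} {x y : ℕ → Bool} (h : cns b x = cns b y) : x = y := by
  have := congrArg shft h
  simpa [shft_cns] using this

theorem cat_nil (x : ℕ → Bool) : cat [] x = x := by
  funext n; simp [cat]

theorem cat_cons (b : Bool) (w : List Bool) (x : ℕ → Bool) :
    cat (b :: w) x = cns b (cat w x) := by
  funext n
  cases n with
  | zero => simp [cat, cns]
  | succ n => simp [cat, cns]

theorem cat_append (w v : List Bool) (x : ℕ → Bool) :
    cat (w ++ v) x = cat w (cat v x) := by
  induction w with
  | nil => simp [cat_nil]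
  | cons b w ih => simp [cat_cons, ih]

theorem shft_iter (x : ℕ → Bool) (n k : ℕ) : shft^[n] x k = x (k + n) := by
  induction n generalizing x with
  | zero => rfl
  | succ n ih => rw [Function.iterate_succ_apply, ih]; simp only [shft]; congr 1

theorem shft_iter_cat (w : List Bool) (x : ℕ → Bool) : shft^[w.length] (cat w x) = x := by
  induction w with
  | nil => simp [cat_nil]
  | cons b w ih => simp [cat_cons, shft_cns, ih]

theorem cat_prefix (x : ℕ → Bool) (n : ℕ) : ∃ w : List Bool, w.length = n ∧ x = cat w (shft^[n] x) := by
  induction n generalizing x with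
  | zero => exact ⟨[], rfl, by simp [cat_nil]⟩
  | succ n ih =>
    obtain ⟨w, hw, hx⟩ := ih (shft x)
    refine ⟨x 0 :: w, by simp [hw], ?_⟩
    rw [cat_cons, Function.iterate_succ_apply, ← hx, cns_eta]

theorem seqLt_iff (u v : ℕ → Bool) : seqLt u v ↔ toLex u < toLex v := Iff.rfl

theorem seqLe_iff (u v : ℕ → Bool) : seqLe u v ↔ toLex u ≤ toLex v := by
  rw [le_iff_lt_or_eq, seqLe, seqLt_iff]; rfl

theorem seqLe_refl (u : ℕ → Bool) : seqLe u u := Or.inr rfl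

theorem seqLe_trans {u v w : ℕ → Bool} (h : seqLe u v) (h' : seqLe v w) : seqLe u w := by
  rw [seqLe_iff] at *; exact h.trans h'

theorem not_seqLe {u v : ℕ → Bool} : ¬ seqLe u v ↔ seqLt v u := by
  rw [seqLe_iff]; exact not_le

theorem not_seqLt {u v : ℕ → Bool} : ¬ seqLt u v ↔ seqLe v u := by
  rw [seqLe_iff]; exact not_lt (a := toLex u) (b := toLex v)

theorem seqLt_cns (b : Bool) (x y : ℕ → Bool) : seqLt (cns b x) (cns b y) ↔ seqLt x y := by
  constructor
  · rintro ⟨n, h1, h2⟩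
    cases n with
    | zero => simp [cns] at h2
    | succ n => exact ⟨n, fun i hi => h1 (i+1) (by omega), h2⟩
  · rintro ⟨n, h1, h2⟩
    refine ⟨n+1, fun i hi => ?_, h2⟩
    cases i with
    | zero => rfl
    | succ i => exact h1 i (by omega)

theorem seqLt_ft (x y : ℕ → Bool) : seqLt (cns false x) (cns true y) :=
  ⟨0, fun i hi => by omega, by simp [cns]⟩

theorem seqLe_ft (x y : ℕ → Bool) : seqLe (cns false x) (cns true y) := Or.inl (seqLt_ft x y)

theorem not_seqLe_tf (x y : ℕ → Bool) : ¬ seqLe (cns true x) (cns false y) :=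
  not_seqLe.2 (seqLt_ft y x)

theorem seqLe_cns (b : Bool) (x y : ℕ → Bool) : seqLe (cns b x) (cns b y) ↔ seqLe x y := by
  rw [← not_seqLt, ← not_seqLt, seqLt_cns]

theorem seqLt_cat (w : List Bool) (x y : ℕ → Bool) : seqLt (cat w x) (cat w y) ↔ seqLt x y := by
  induction w with
  | nil => simp [cat_nil]
  | cons b w ih => rw [cat_cons, cat_cons, seqLt_cns, ih]

/-- `0x ≤ x`. -/
theorem cns_false_le (x : ℕ → Bool) : seqLe (cns false x) x := by
  rw [← not_seqLt]
  rintro ⟨n, h1, h2⟩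
  have h : ∀ i ≤ n, cns false x i = false := by
    intro i
    induction i with
    | zero => intro _; rfl
    | succ i ih => intro hi; show x i = false; rw [h1 i (by omega)]; exact ih (by omega)
  rw [h n le_rfl] at h2
  exact bool_not_lt_false h2

/-- `x ≤ 1x`. -/
theorem le_cns_true (x : ℕ → Bool) : seqLe x (cns true x) := by
  rw [← not_seqLt]
  rintro ⟨n, h1, h2⟩
  have h : ∀ i ≤ n, cns true x i = true := by
    intro i
    induction i with
    | zero => intro _; rfl
    | succ i ih => intro hi; show x i = true; rw [← h1 i (by omega)]; exact ih (by omega)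
  rw [h n le_rfl] at h2
  exact bool_not_true_lt h2

theorem cst_false_le (x : ℕ → Bool) : seqLe (cst false) x := by
  rw [← not_seqLt]
  rintro ⟨n, h1, h2⟩
  exact bool_not_lt_false h2

theorem le_cst_true (x : ℕ → Bool) : seqLe x (cst true) := by
  rw [← not_seqLt]
  rintro ⟨n, h1, h2⟩
  exact bool_not_true_lt h2

/-- The letter `b` occurs infinitely often. -/
def InfB (b : Bool) (x : ℕ → Bool) : Prop := ∀ n, ∃ m, n ≤ m ∧ x m = b

theorem InfB_cns {b c : Bool} {x : ℕ → Bool} : InfB b (cns c x) ↔ InfB b x := by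
  constructor
  · intro h n
    obtain ⟨m, hm, hx⟩ := h (n+1)
    obtain ⟨k, rfl⟩ : ∃ k, m = k + 1 := ⟨m - 1, by omega⟩
    exact ⟨k, by omega, hx⟩
  · intro h n
    obtain ⟨m, hm, hx⟩ := h n
    exact ⟨m+1, by omega, hx⟩

theorem InfB_cat {b : Bool} {w : List Bool} {x : ℕ → Bool} : InfB b (cat w x) ↔ InfB b x := by
  induction w with
  | nil => rw [cat_nil]
  | cons c w ih => rw [cat_cons, InfB_cns, ih]

theorem InfB_shft {b : Bool} {x : ℕ → Bool} : InfB b (shft x) ↔ InfB b x := by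
  conv_rhs => rw [← cns_eta x]
  rw [InfB_cns]

theorem InfB_iter {b : Bool} {x : ℕ → Bool} (n : ℕ) : InfB b (shft^[n] x) ↔ InfB b x := by
  induction n with
  | zero => rfl
  | succ n ih => rw [Function.iterate_succ_apply', InfB_shft, ih]

theorem InfB_cst (b : Bool) : InfB b (cst b) := fun n => ⟨n, le_rfl, rfl⟩

/-- Agreement of the first `n` letters. -/
def Agree (n : ℕ) (x y : ℕ → Bool) : Prop := ∀ i < n, x i = y i

theorem Agree_cns {n : ℕ} {x y : ℕ → Bool} (b : Bool) (h : Agree n x y) :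
    Agree (n+1) (cns b x) (cns b y) := by
  intro i hi
  cases i with
  | zero => rfl
  | succ i => exact h i (by omega)

theorem Agree_cat (w : List Bool) (x y : ℕ → Bool) : Agree w.length (cat w x) (cat w y) := by
  induction w with
  | nil => intro i hi; simp at hi
  | cons b w ih => rw [cat_cons, cat_cons]; exact Agree_cns b ih

theorem Agree.mono {m n : ℕ} {x y : ℕ → Bool} (h : Agree n x y) (hm : m ≤ n) : Agree m x y :=
  fun i hi => h i (by omega)

theorem Agree.exists_cat {n : ℕ} {x y : ℕ → Bool} (h : Agree n x y) :
    ∃ (w : List Bool) (x' y' : ℕ → Bool), w.length = n ∧ x = cat w x' ∧ y = cat w y' := by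
  induction n generalizing x y with
  | zero => exact ⟨[], x, y, rfl, by simp [cat_nil], by simp [cat_nil]⟩
  | succ n ih =>
    obtain ⟨w, x', y', hw, h1, h2⟩ := ih (x := shft x) (y := shft y) (fun i hi => h (i+1) (by omega))
    refine ⟨x 0 :: w, x', y', by simp [hw], ?_, ?_⟩
    · rw [cat_cons, ← h1, cns_eta]
    · rw [cat_cons, ← h2, h 0 (by omega), cns_eta]

/-- Numerical value of a letter. -/
def bv (b : Bool) : ℝ := if b then 1 else 0

theorem pi_summable (w : ℕ → Bool) :
    Summable (fun n : ℕ => (if w n then (1:ℝ) else 0) / 2 ^ (n+1)) := by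
  have h : Summable (fun n : ℕ => (1/2:ℝ)^n) := summable_geometric_two
  refine Summable.of_nonneg_of_le (fun n => by positivity) (fun n => ?_) h
  rw [one_div_pow]
  have : (2:ℝ)^n ≤ 2^(n+1) := pow_le_pow_right₀ (by norm_num) (by omega)
  split_ifs
  · gcongr
  · rw [zero_div]; positivity

theorem pi_cns (b : Bool) (x : ℕ → Bool) : piMap (cns b x) = (bv b + piMap x) / 2 := by
  unfold piMap
  rw [(pi_summable (cns b x)).tsum_eq_zero_add]
  have : ∀ n : ℕ, (if cns b x (n+1) then (1:ℝ) else 0) / 2 ^ (n+1+1)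
      = ((if x n then (1:ℝ) else 0) / 2 ^ (n+1)) / 2 := by
    intro n
    show (if x n then (1:ℝ) else 0) / 2 ^ (n+1+1) = _
    rw [pow_succ _ (n+1), div_div]
  simp only [this, tsum_div_const]
  show (if b then (1:ℝ) else 0) / 2 ^ (0+1) + _ = _
  rw [bv]
  generalize (if b then (1:ℝ) else 0) = c
  ring

theorem pi_eta (x : ℕ → Bool) : piMap x = (bv (x 0) + piMap (shft x)) / 2 := by
  rw [← pi_cns, cns_eta]

theorem pi_nonneg (x : ℕ → Bool) : 0 ≤ piMap x := by
  unfold piMap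
  exact tsum_nonneg (fun n => by positivity)

theorem pi_cst_true : piMap (cst true) = 1 := by
  have := pi_cns true (cst true)
  rw [← cst_eq] at this
  simp [bv] at this
  linarith

theorem pi_le_one (x : ℕ → Bool) : piMap x ≤ 1 := by
  rw [← pi_cst_true]
  unfold piMap
  refine (pi_summable x).tsum_le_tsum (fun n => ?_) (pi_summable _)
  gcongr
  simp only [cst]
  split_ifs <;> norm_num

theorem bv_nonneg (b : Bool) : 0 ≤ bv b := by unfold bv; split_ifs <;> norm_num

theorem bv_le_one (b : Bool) : bv b ≤ 1 := by unfold bv; split_ifs <;> norm_num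

theorem pi_pos_of_mem {x : ℕ → Bool} {n : ℕ} (h : x n = true) : 0 < piMap x := by
  induction n generalizing x with
  | zero => rw [pi_eta, h]; have := pi_nonneg (shft x); simp [bv]; linarith
  | succ n ih =>
    rw [pi_eta]
    have := ih (x := shft x) h
    have := bv_nonneg (x 0)
    linarith

theorem pi_lt_one_of_mem {x : ℕ → Bool} {n : ℕ} (h : x n = false) : piMap x < 1 := by
  induction n generalizing x with
  | zero => rw [pi_eta, h]; have := pi_le_one (shft x); simp [bv]; linarith
  | succ n ih =>
    rw [pi_eta]
    have := ih (x := shft x) h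
    have := bv_le_one (x 0)
    linarith

theorem pi_pos {x : ℕ → Bool} (h : InfB true x) : 0 < piMap x := by
  obtain ⟨m, _, hm⟩ := h 0
  exact pi_pos_of_mem hm

theorem pi_lt_one {x : ℕ → Bool} (h : InfB false x) : piMap x < 1 := by
  obtain ⟨m, _, hm⟩ := h 0
  exact pi_lt_one_of_mem hm

theorem seqLt_split {u v : ℕ → Bool} (h : seqLt u v) : ∃ (w : List Bool) (u' v' : ℕ → Bool),
    u = cat w (cns false u') ∧ v = cat w (cns true v') := by
  obtain ⟨n, h1, h2⟩ := h
  obtain ⟨w, x', y', hw, rfl, rfl⟩ := Agree.exists_cat (n := n) h1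
  refine ⟨w, shft x', shft y', ?_, ?_⟩
  · have : x' 0 = false := by
      have h3 : cat w x' n = x' 0 := by simp [cat, hw]
      rw [h3] at h2; cases h : x' 0
      · rfl
      · rw [h] at h2; exact (bool_not_true_lt h2).elim
    rw [← this, cns_eta]
  · have : y' 0 = true := by
      have h3 : cat w y' n = y' 0 := by simp [cat, hw]
      rw [h3] at h2; cases h : y' 0
      · rw [h] at h2; exact (bool_not_lt_false h2).elim
      · rfl
    rw [← this, cns_eta]

theorem pi_cat_lt {w : List Bool} {x y : ℕ → Bool} : piMap (cat w x) < piMap (cat w y) ↔ piMap x < piMap y := by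
  induction w with
  | nil => rw [cat_nil, cat_nil]
  | cons b w ih =>
    rw [cat_cons, cat_cons, pi_cns, pi_cns, ← ih]
    constructor <;> intro h <;> linarith

theorem pi_mono_lt {u v : ℕ → Bool} (h : seqLt u v) : piMap u ≤ piMap v := by
  obtain ⟨w, u', v', rfl, rfl⟩ := seqLt_split h
  rw [← not_lt, pi_cat_lt, not_lt, pi_cns, pi_cns]
  have := pi_le_one u'; have := pi_nonneg v'
  simp [bv]; linarith

theorem pi_mono {u v : ℕ → Bool} (h : seqLe u v) : piMap u ≤ piMap v := by
  rcases h with h | rfl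
  · exact pi_mono_lt h
  · rfl

theorem pi_strict_right {u v : ℕ → Bool} (h : seqLt u v) (hv : InfB true v) : piMap u < piMap v := by
  obtain ⟨w, u', v', rfl, rfl⟩ := seqLt_split h
  rw [pi_cat_lt, pi_cns, pi_cns]
  rw [InfB_cat, InfB_cns] at hv
  have := pi_le_one u'; have := pi_pos hv
  simp [bv]; linarith

theorem pi_strict_left {u v : ℕ → Bool} (h : seqLt u v) (hu : InfB false u) : piMap u < piMap v := by
  obtain ⟨w, u', v', rfl, rfl⟩ := seqLt_split h
  rw [pi_cat_lt, pi_cns, pi_cns]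
  rw [InfB_cat, InfB_cns] at hu
  have := pi_nonneg v'; have := pi_lt_one hu
  simp [bv]; linarith

theorem pi_agree {n : ℕ} {x y : ℕ → Bool} (h : Agree n x y) : |piMap x - piMap y| ≤ (1/2)^n := by
  obtain ⟨w, x', y', rfl, rfl, rfl⟩ := h.exists_cat
  clear h
  induction w with
  | nil =>
    rw [cat_nil, cat_nil, abs_le]
    have := pi_nonneg x'; have := pi_le_one x'; have := pi_nonneg y'; have := pi_le_one y'
    simp; constructor <;> linarith
  | cons b w ih =>
    rw [cat_cons, cat_cons, pi_cns, pi_cns, List.length_cons, pow_succ]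
    rw [show (bv b + piMap (cat w x')) / 2 - (bv b + piMap (cat w y')) / 2
      = (piMap (cat w x') - piMap (cat w y')) * (1/2) by ring, abs_mul]
    rw [abs_of_pos (by norm_num : (0:ℝ) < 1/2)]
    gcongr

/-- If `x k` agrees with `y` on at least `k` letters then values converge. -/
theorem exists_close {x : ℕ → ℕ → Bool} {y : ℕ → Bool} (h : ∀ k, Agree k (x k) y) {ε : ℝ}
    (hε : 0 < ε) : ∃ k, |piMap (x k) - piMap y| < ε := by
  obtain ⟨k, hk⟩ := exists_pow_lt_of_lt_one hε (by norm_num : (1/2:ℝ) < 1)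
  exact ⟨k, (pi_agree (h k)).trans_lt hk⟩

/-! ### Elementary substitutions -/

/-- Elementary substitutions: `0 ↦ 0` or `01`, `1 ↦ 1` or `10`. -/
def fe (c : Bool × Bool) (b : Bool) : List Bool :=
  if b then (if c.2 then [true, false] else [true]) else (if c.1 then [false, true] else [false])

theorem fe_cases (c : Bool × Bool) (b : Bool) : fe c b = [b] ∨ fe c b = [b, !b] := by
  rcases c with ⟨c1, c2⟩
  cases c1 <;> cases c2 <;> cases b <;> simp [fe]

theorem fe_length_pos (c : Bool × Bool) (b : Bool) : 1 ≤ (fe c b).length := by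
  rcases fe_cases c b with h | h <;> simp [h]

/-- Elementary substitution on infinite sequences. -/
def isub1 (c : Bool × Bool) (x : ℕ → Bool) (n : ℕ) : Bool :=
  if _h : n < (fe c (x 0)).length then (fe c (x 0)).getD n false
  else isub1 c (shft x) (n - (fe c (x 0)).length)
termination_by n
decreasing_by
  have := fe_length_pos c (x 0)
  omega

theorem isub1_eta (c : Bool × Bool) (x : ℕ → Bool) :
    isub1 c x = cat (fe c (x 0)) (isub1 c (shft x)) := by
  funext n
  rw [isub1, cat]
  split_ifs <;> rfl

theorem isub1_cns (c : Bool × Bool) (b : Bool) (x : ℕ → Bool) :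
    isub1 c (cns b x) = cat (fe c b) (isub1 c x) := by
  rw [isub1_eta]; rfl

/-- Elementary substitution on words. -/
def lsub1 (c : Bool × Bool) (w : List Bool) : List Bool := w.flatMap (fe c)

theorem isub1_cat (c : Bool × Bool) (w : List Bool) (x : ℕ → Bool) :
    isub1 c (cat w x) = cat (lsub1 c w) (isub1 c x) := by
  induction w with
  | nil => simp [lsub1, cat_nil]
  | cons b w ih =>
    rw [cat_cons, isub1_cns, ih, ← cat_append]; rfl

theorem lsub1_length (c : Bool × Bool) (w : List Bool) : w.length ≤ (lsub1 c w).length := by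
  induction w with
  | nil => simp
  | cons b w ih =>
    have := fe_length_pos c b
    simp only [lsub1, List.flatMap_cons, List.length_cons, List.length_append] at *
    omega

theorem isub1_agree (c : Bool × Bool) {n : ℕ} {x y : ℕ → Bool} (h : Agree n x y) :
    Agree n (isub1 c x) (isub1 c y) := by
  obtain ⟨w, x', y', rfl, rfl, rfl⟩ := h.exists_cat
  rw [isub1_cat, isub1_cat]
  exact (Agree_cat _ _ _).mono (lsub1_length c w)

theorem isub1_cns' (c : Bool × Bool) (b : Bool) (x : ℕ → Bool) :
    ∃ y, isub1 c (cns b x) = cns b y := by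
  rw [isub1_cns]
  rcases fe_cases c b with h | h <;> rw [h, cat_cons] <;> exact ⟨_, rfl⟩

theorem isub1_head (c : Bool × Bool) (x : ℕ → Bool) : isub1 c x 0 = x 0 := by
  obtain ⟨y, hy⟩ := isub1_cns' c (x 0) (shft x)
  rw [cns_eta] at hy
  rw [hy]; rfl

theorem isub1_lt (c : Bool × Bool) {x y : ℕ → Bool} (h : seqLt x y) :
    seqLt (isub1 c x) (isub1 c y) := by
  obtain ⟨w, u', v', rfl, rfl⟩ := seqLt_split h
  rw [isub1_cat, isub1_cat, seqLt_cat]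
  obtain ⟨y1, h1⟩ := isub1_cns' c false u'
  obtain ⟨y2, h2⟩ := isub1_cns' c true v'
  rw [h1, h2]
  exact seqLt_ft _ _

theorem isub1_le (c : Bool × Bool) {x y : ℕ → Bool} (h : seqLe x y) :
    seqLe (isub1 c x) (isub1 c y) := by
  rcases h with h | rfl
  · exact Or.inl (isub1_lt c h)
  · exact seqLe_refl _

theorem isub1_le_iff (c : Bool × Bool) {x y : ℕ → Bool} :
    seqLe (isub1 c x) (isub1 c y) ↔ seqLe x y := by
  refine ⟨fun h => ?_, isub1_le c⟩
  by_contra h'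
  exact (not_seqLe.2 (isub1_lt c (not_seqLe.1 h'))) h

theorem isub1_inj (c : Bool × Bool) : Function.Injective (isub1 c) := by
  intro x y h
  have h1 : seqLe x y := (isub1_le_iff c).1 (Or.inr h)
  have h2 : seqLe y x := (isub1_le_iff c).1 (Or.inr h.symm)
  rw [seqLe_iff] at h1 h2
  exact toLex.injective (le_antisymm h1 h2)

/-- Tails of the image start with images of tails. -/
theorem isub1_tail (c : Bool × Bool) (x : ℕ → Bool) (j : ℕ) :
    ∃ k, j ≤ k ∧ isub1 c (shft^[j] x) = shft^[k] (isub1 c x) := by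
  induction j with
  | zero => exact ⟨0, le_rfl, rfl⟩
  | succ j ih =>
    obtain ⟨k, hjk, hk⟩ := ih
    have hp := fe_length_pos c (shft^[j] x 0)
    refine ⟨(fe c (shft^[j] x 0)).length + k, by omega, ?_⟩
    rw [Function.iterate_add_apply shft (fe c (shft^[j] x 0)).length k, ← hk,
      isub1_eta c (shft^[j] x), shft_iter_cat, Function.iterate_succ_apply']

theorem isub1_inf (c : Bool × Bool) {b : Bool} {x : ℕ → Bool} (h : InfB b x) : InfB b (isub1 c x) := by
  intro n
  obtain ⟨m, hm, hx⟩ := h n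
  obtain ⟨k, hk, hk'⟩ := isub1_tail c x m
  refine ⟨k, by omega, ?_⟩
  have := isub1_head c (shft^[m] x)
  rw [hk', shft_iter, shft_iter] at this
  simpa [hx] using this

/-- All tails of the image. -/
theorem isub1_tails (c : Bool × Bool) (x : ℕ → Bool) (n : ℕ) :
    ∃ j, shft^[n] (isub1 c x) = isub1 c (shft^[j] x) ∨
      ∃ b, fe c b = [b, !b] ∧ shft^[n] (isub1 c x) = cns (!b) (isub1 c (shft^[j] x)) := by
  induction n with
  | zero => exact ⟨0, Or.inl rfl⟩
  | succ n ih =>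
    obtain ⟨j, h | ⟨b, hb, h⟩⟩ := ih
    · refine ⟨j+1, ?_⟩
      rw [Function.iterate_succ_apply', h, isub1_eta, Function.iterate_succ_apply']
      rcases fe_cases c (shft^[j] x 0) with h1 | h1
      · left; rw [h1, cat_cons, cat_nil, shft_cns]
      · right; refine ⟨_, h1, ?_⟩
        rw [h1, cat_cons, cat_cons, cat_nil, shft_cns]
    · refine ⟨j, Or.inl ?_⟩
      rw [Function.iterate_succ_apply', h, shft_cns]

/-- Decoding. -/
theorem decode (c : Bool × Bool) (D : Set (ℕ → Bool))
    (hD : ∀ y ∈ D, ∃ b, ∃ y' ∈ D, y = cat (fe c b) y') (y : ℕ → Bool) (hy : y ∈ D) :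
    ∃ z, y = isub1 c z := by
  choose! b g hg hb using hD
  let z : (ℕ → Bool) → ℕ → Bool := fun y n => b (g^[n] y)
  refine ⟨z y, ?_⟩
  have key : ∀ n, ∀ y ∈ D, y n = isub1 c (z y) n := by
    intro n
    induction n using Nat.strong_induction_on with
    | _ n ih =>
      intro y hy
      have hz : shft (z y) = z (g y) := by
        funext m; simp [z, shft]
      have hz0 : z y 0 = b y := rfl
      rw [isub1_eta, hz, hz0]
      conv_lhs => rw [hb y hy]
      have hp := fe_length_pos c (b y)
      simp only [cat]
      split_ifs with h
      · rfl
      · exact ih _ (by omega) _ (hg y hy)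
  funext n
  exact key n y hy

/-! ### The lexicographic worlds -/

/-- Sequences whose 0-tails are at most `α` and whose 1-tails are at least `β`. -/
def XW (α β : ℕ → Bool) : Set (ℕ → Bool) :=
  {x | ∀ n, (x n = false → seqLe (shft^[n] x) α) ∧ (x n = true → seqLe β (shft^[n] x))}

/-- Strong version. -/
def XS (α β : ℕ → Bool) : Set (ℕ → Bool) :=
  {x | ∀ n, seqLe (cns false (shft^[n] x)) α ∧ seqLe β (cns true (shft^[n] x))}

theorem XS_sub (c : Bool × Bool) {α β x : ℕ → Bool} (hx : x ∈ XS α β) :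
    isub1 c x ∈ XS (isub1 c α) (isub1 c β) := by
  have h0 : ∀ j, seqLe (isub1 c (cns false (shft^[j] x))) (isub1 c α) :=
    fun j => isub1_le c (hx j).1
  have h1 : ∀ j, seqLe (isub1 c β) (isub1 c (cns true (shft^[j] x))) :=
    fun j => isub1_le c (hx j).2
  have g0 : ∀ j, seqLe (cns false (isub1 c (shft^[j] x))) (isub1 c α) := by
    intro j
    refine seqLe_trans ?_ (h0 j)
    rw [isub1_cns]
    rcases fe_cases c false with h | h <;> rw [h]
    · rw [cat_cons, cat_nil]; exact seqLe_refl _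
    · rw [cat_cons, cat_cons, cat_nil, seqLe_cns]; exact le_cns_true _
  have g1 : ∀ j, seqLe (isub1 c β) (cns true (isub1 c (shft^[j] x))) := by
    intro j
    refine seqLe_trans (h1 j) ?_
    rw [isub1_cns]
    rcases fe_cases c true with h | h <;> rw [h]
    · rw [cat_cons, cat_nil]; exact seqLe_refl _
    · rw [cat_cons, cat_cons, cat_nil, seqLe_cns]; exact cns_false_le _
  intro n
  obtain ⟨j, h | ⟨b, hb, h⟩⟩ := isub1_tails c x n
  · rw [h]; exact ⟨g0 j, g1 j⟩
  · rw [h]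
    cases b with
    | false =>
      constructor
      · have := h0 j
        rwa [isub1_cns, hb, cat_cons, cat_cons, cat_nil] at this
      · refine seqLe_trans (g1 j) ?_
        rw [seqLe_cns]; exact le_cns_true _
    | true =>
      constructor
      · refine seqLe_trans ?_ (g0 j)
        rw [seqLe_cns]; exact cns_false_le _
      · have := h1 j
        rwa [isub1_cns, hb, cat_cons, cat_cons, cat_nil] at this

theorem XW_iter {α β x : ℕ → Bool} (hx : x ∈ XW α β) (k : ℕ) : shft^[k] x ∈ XW α β := by
  intro n
  have := hx (n + k)
  rw [← Function.iterate_add_apply, shft_iter]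
  exact this

theorem XW_of_isub1 (c : Bool × Bool) {α β z : ℕ → Bool}
    (hz : isub1 c z ∈ XW (isub1 c α) (isub1 c β)) : z ∈ XW α β := by
  intro n
  obtain ⟨k, hk, hk'⟩ := isub1_tail c z n
  have hh : isub1 c z k = z n := by
    have := isub1_head c (shft^[n] z)
    rw [hk', shft_iter, shft_iter] at this
    simpa using this
  have := hz k
  rw [hh, ← hk', isub1_le_iff, isub1_le_iff] at this
  exact this

/-- Sequences having a tail in `C`. -/
def Ev (C : Set (ℕ → Bool)) : Set (ℕ → Bool) := {x | ∃ k, shft^[k] x ∈ C}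

theorem Ev_countable {C : Set (ℕ → Bool)} (hC : C.Countable) : (Ev C).Countable := by
  have : Ev C ⊆ ⋃ w : List Bool, (cat w) '' C := by
    rintro x ⟨k, hk⟩
    obtain ⟨w, _, hw⟩ := cat_prefix x k
    exact Set.mem_iUnion.2 ⟨w, _, hk, hw.symm⟩
  exact (Set.countable_iUnion fun w => hC.image _).mono this

/-- The four eventually trivial sequences. -/
def Triv : Set (ℕ → Bool) := {cst false, cst true, isub1 (true, true) (cst false), isub1 (true, true) (cst true)}

theorem Triv_countable : Triv.Countable := by
  unfold Triv; exact (Set.toFinite _).countable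

theorem cns3 (x : ℕ → Bool) : cns (x 0) (cns (x 1) (shft^[2] x)) = x := by
  have h1 : cns (x 1) (shft^[2] x) = shft x := cns_eta (shft x)
  rw [h1, cns_eta]

/-- `(01)^∞`. -/
def alt0 : ℕ → Bool := isub1 (true, true) (cst false)
/-- `(10)^∞`. -/
def alt1 : ℕ → Bool := isub1 (true, true) (cst true)

theorem alt0_eq : alt0 = cns false (cns true alt0) := by
  have : isub1 (true, true) (cns false (cst false)) = cns false (cns true alt0) := by
    rw [isub1_cns]; simp [fe, cat_cons, cat_nil, alt0]
  rw [← this, ← cst_eq]; rfl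

theorem alt1_eq : alt1 = cns true (cns false alt1) := by
  have : isub1 (true, true) (cns true (cst true)) = cns true (cns false alt1) := by
    rw [isub1_cns]; simp [fe, cat_cons, cat_nil, alt1]
  rw [← this, ← cst_eq]; rfl

theorem alt_of_step {y z : ℕ → Bool} (hz : z = cns (z 0) (cns (!(z 0)) z)) (h0 : y 0 = z 0)
    (h : ∀ i, y (i+1) = !(y i)) : y = z := by
  have h2 : ∀ i, z (i+2) = z i := by
    intro i; conv_lhs => rw [hz]
    rfl
  have h1 : z 1 = !(z 0) := by conv_lhs => rw [hz]
                               rfl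
  have key : ∀ i, y i = z i ∧ y (i+1) = z (i+1) := by
    intro i
    induction i with
    | zero => exact ⟨h0, by rw [h, h0, h1]⟩
    | succ i ih => exact ⟨ih.2, by rw [h, h, h2, ih.1]; simp⟩
  funext i; exact (key i).1

theorem not_const {x : ℕ → Bool} (h : ∀ n, x (n+1) = x n) : x = cst (x 0) := by
  funext n
  induction n with
  | zero => rfl
  | succ n ih => rw [h, ih]; rfl

theorem cst_mem_Triv (b : Bool) : cst b ∈ Triv := by
  cases b <;> simp [Triv]

theorem XW_red_aux (c : Bool × Bool) {α β x : ℕ → Bool} (hα : α 0 = false) (hβ : β 0 = true)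
    (hx : x ∈ XW (isub1 c α) (isub1 c β)) :
    x ∈ Ev Triv ∨ ∃ k z, shft^[k] x = isub1 c z := by
  have hα' : seqLe α (cns false (cst true)) := by
    rw [← cns_eta α, hα, seqLe_cns]; exact le_cst_true _
  have hβ' : seqLe (cns true (cst false)) β := by
    rw [← cns_eta β, hβ, seqLe_cns]; exact cst_false_le _
  have ha := isub1_le c hα'
  have hb := isub1_le c hβ'
  have hx0 : ∀ y ∈ XW (isub1 c α) (isub1 c β), y 0 = false →
      seqLe y (isub1 c (cns false (cst true))) := fun y hy h => seqLe_trans ((hy 0).1 h) ha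
  have hx1 : ∀ y ∈ XW (isub1 c α) (isub1 c β), y 0 = true →
      seqLe (isub1 c (cns true (cst false))) y := fun y hy h => seqLe_trans hb ((hy 0).2 h)
  clear ha hb hα' hβ'
  generalize hX : XW (isub1 c α) (isub1 c β) = X at *
  have hXs : ∀ y ∈ X, ∀ k, shft^[k] y ∈ X := by
    subst hX; intro y hy k; exact XW_iter hy k
  obtain ⟨c1, c2⟩ := c
  cases c1 <;> cases c2
  · -- identity
    right
    obtain ⟨z, hz⟩ := decode (false, false) Set.univ (fun y _ => ⟨y 0, shft y, trivial, by
      cases h : y 0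
      · simp only [fe]; simp only [Bool.false_eq_true, if_false]; rw [cat_cons, cat_nil, ← h, cns_eta]
      · simp only [fe]; simp only [Bool.false_eq_true, if_false, if_true]; rw [cat_cons, cat_nil, ← h, cns_eta]⟩) x trivial
    exact ⟨0, z, hz⟩
  · -- `A`
    by_cases hc : ∃ n, x n = false
    · right
      obtain ⟨n, hn⟩ := hc
      have nof : ∀ y ∈ X, y 0 = false → y 1 = false ∨ y 2 = false := by
        intro y hy h0
        by_contra hcon
        push Not at hcon
        simp only [ne_eq, Bool.not_eq_false] at hcon
        have h := hx0 y hy h0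
        rw [isub1_cns, cst_eq, isub1_cns, ← cns3 y, ← cns_eta (shft^[2] y), h0, hcon.1,
          show shft^[2] y 0 = true from hcon.2] at h
        simp only [fe, if_true, Bool.false_eq_true, if_false, cat_cons, cat_nil, seqLe_cns] at h
        exact not_seqLe_tf _ _ h
      obtain ⟨z, hz⟩ := decode (false, true) {y | y ∈ X ∧ (y 0 = false ∨ y 1 = false)} (by
        rintro y ⟨hy, h⟩
        cases h0 : y 0
        · refine ⟨false, shft y, ⟨hXs y hy 1, nof y hy h0⟩, ?_⟩
          simp only [fe, Bool.false_eq_true, if_false, cat_cons, cat_nil]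
          rw [← h0, cns_eta]
        · have h1 : y 1 = false := by simpa [h0] using h
          refine ⟨true, shft^[2] y, ⟨hXs y hy 2, nof (shft^[1] y) (hXs y hy 1) h1⟩, ?_⟩
          simp only [fe, if_true, cat_cons, cat_nil]
          rw [← h0, ← h1, cns3]) (shft^[n] x) ⟨hXs x hx n, Or.inl (by rw [shft_iter]; simpa using hn)⟩
      exact ⟨n, z, hz⟩
    · left
      push Not at hc
      refine ⟨0, ?_⟩
      have : x = cst true := by funext n; simpa [cst] using hc n
      simpa [this] using cst_mem_Triv true
  · -- `B`
    by_cases hc : ∃ n, x n = true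
    · right
      obtain ⟨n, hn⟩ := hc
      have nof : ∀ y ∈ X, y 0 = true → y 1 = true ∨ y 2 = true := by
        intro y hy h0
        by_contra hcon
        push Not at hcon
        simp only [ne_eq, Bool.not_eq_true] at hcon
        have h := hx1 y hy h0
        rw [isub1_cns, cst_eq, isub1_cns, ← cns3 y, ← cns_eta (shft^[2] y), h0, hcon.1,
          show shft^[2] y 0 = false from hcon.2] at h
        simp only [fe, if_true, Bool.false_eq_true, if_false, cat_cons, cat_nil, seqLe_cns] at h
        exact not_seqLe_tf _ _ h
      obtain ⟨z, hz⟩ := decode (true, false) {y | y ∈ X ∧ (y 0 = true ∨ y 1 = true)} (by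
        rintro y ⟨hy, h⟩
        cases h0 : y 0
        · have h1 : y 1 = true := by simpa [h0] using h
          refine ⟨false, shft^[2] y, ⟨hXs y hy 2, nof (shft^[1] y) (hXs y hy 1) h1⟩, ?_⟩
          simp only [fe, if_true, Bool.false_eq_true, if_false, cat_cons, cat_nil]
          rw [← h0, ← h1, cns3]
        · refine ⟨true, shft y, ⟨hXs y hy 1, nof y hy h0⟩, ?_⟩
          simp only [fe, if_true, Bool.false_eq_true, if_false, cat_cons, cat_nil]
          rw [← h0, cns_eta]) (shft^[n] x) ⟨hXs x hx n, Or.inl (by rw [shft_iter]; simpa using hn)⟩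
      exact ⟨n, z, hz⟩
    · left
      push Not at hc
      refine ⟨0, ?_⟩
      have : x = cst false := by funext n; simpa [cst] using hc n
      simpa [this] using cst_mem_Triv false
  · -- `M`
    have e0 : isub1 (true, true) (cns false (cst true)) = cns false (cns true alt1) := by
      rw [isub1_cns]; simp [fe, cat_cons, cat_nil, alt1]
    have e1 : isub1 (true, true) (cns true (cst false)) = cns true (cns false alt0) := by
      rw [isub1_cns]; simp [fe, cat_cons, cat_nil, alt0]
    rw [e0] at hx0
    rw [e1] at hx1
    have dec : ∀ y ∈ X, seqLe alt0 y → seqLe y alt1 → ∃ z, y = isub1 (true, true) z := by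
      intro y hy h1 h2
      refine decode (true, true) {y | y ∈ X ∧ seqLe alt0 y ∧ seqLe y alt1} ?_ y ⟨hy, h1, h2⟩
      clear! y
      rintro y ⟨hy, h1, h2⟩
      cases h0 : y 0
      · have h3 : y 1 = true := by
          by_contra h3
          simp only [Bool.not_eq_true] at h3
          rw [← cns3 y, h0, h3, alt0_eq, seqLe_cns] at h1
          exact not_seqLe_tf _ _ h1
        refine ⟨false, shft^[2] y, ⟨hXs y hy 2, ?_, ?_⟩, ?_⟩
        · rw [← cns3 y, h0, h3, alt0_eq, seqLe_cns, seqLe_cns] at h1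
          exact h1
        · have h := hx0 y hy h0
          rw [← cns3 y, h0, h3, seqLe_cns, seqLe_cns] at h
          exact h
        · simp only [fe, if_true, Bool.false_eq_true, if_false, cat_cons, cat_nil]
          rw [← h0, ← h3, cns3]
      · have h3 : y 1 = false := by
          by_contra h3
          simp only [Bool.not_eq_false] at h3
          rw [← cns3 y, h0, h3, alt1_eq, seqLe_cns] at h2
          exact not_seqLe_tf _ _ h2
        refine ⟨true, shft^[2] y, ⟨hXs y hy 2, ?_, ?_⟩, ?_⟩
        · have h := hx1 y hy h0
          rw [← cns3 y, h0, h3, seqLe_cns, seqLe_cns] at h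
          exact h
        · rw [← cns3 y, h0, h3, alt1_eq, seqLe_cns, seqLe_cns] at h2
          exact h2
        · simp only [fe, if_true, cat_cons, cat_nil]
          rw [← h0, ← h3, cns3]
    by_cases hc1 : ∃ n, x n ≠ x (n+1) ∧ x (n+1) = x (n+2)
    · right
      obtain ⟨n, hn, hn'⟩ := hc1
      refine ⟨n+2, ?_⟩
      have hX1 : shft^[n] x ∈ X := hXs x hx n
      have q0 : shft^[n] x 0 = x n := by rw [shft_iter]; simp
      have q1 : shft^[n] x 1 = x (n+1) := by rw [shft_iter]; congr 1; omega
      have q2 : shft^[n+1] x 0 = x (n+1) := by rw [shft_iter]; simp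
      have hit : shft^[n+2] x = shft^[2] (shft^[n] x) := by
        rw [add_comm, Function.iterate_add_apply]
      have hit' : shft^[n+1] x = shft (shft^[n] x) := by
        rw [Function.iterate_succ_apply']
      have q3 : shft^[n+2] x 0 = x (n+1) := by rw [shft_iter, hn']; simp
      cases h0 : x n
      · have h1 : x (n+1) = true := by simpa [h0] using hn.symm
        have h := hx0 _ hX1 (q0.trans h0)
        rw [← cns3 (shft^[n] x), q0, q1, h0, h1, seqLe_cns, seqLe_cns, ← hit] at h
        refine dec _ (hXs x hx _) ?_ h
        rw [← cns_eta (shft^[n+2] x), q3, h1, alt0_eq]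
        exact seqLe_ft _ _
      · have h1 : x (n+1) = false := by simpa [h0] using hn.symm
        have h := hx1 _ hX1 (q0.trans h0)
        rw [← cns3 (shft^[n] x), q0, q1, h0, h1, seqLe_cns, seqLe_cns, ← hit] at h
        refine dec _ (hXs x hx _) h ?_
        rw [← cns_eta (shft^[n+2] x), q3, h1, alt1_eq]
        exact seqLe_ft _ _
    · left
      push Not at hc1
      by_cases hc2 : ∀ n, x (n+1) = x n
      · refine ⟨0, ?_⟩
        rw [not_const hc2]
        exact cst_mem_Triv _
      · push Not at hc2
        obtain ⟨n, hn⟩ := hc2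
        have key : ∀ i, x (n+i) ≠ x (n+i+1) := by
          intro i
          induction i with
          | zero => exact hn.symm
          | succ i ih => exact hc1 _ ih
        have step : ∀ i, shft^[n] x (i+1) = !(shft^[n] x i) := by
          intro i
          rw [shft_iter, shft_iter]
          have := key i
          rw [show i + 1 + n = n + i + 1 by omega, show i + n = n + i by omega]
          cases h : x (n+i) <;> simp [h] at this ⊢ <;> simpa using this
        refine ⟨n, ?_⟩
        cases h0 : shft^[n] x 0
        · have : shft^[n] x = alt0 := by
            refine alt_of_step ?_ ?_ step
            · conv_lhs => rw [alt0_eq]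
              simp [alt0, isub1_head, cst]
            · rw [h0]; simp [alt0, isub1_head, cst]
          rw [this]; simp [Triv, alt0]
        · have : shft^[n] x = alt1 := by
            refine alt_of_step ?_ ?_ step
            · conv_lhs => rw [alt1_eq]
              simp [alt1, isub1_head, cst]
            · rw [h0]; simp [alt1, isub1_head, cst]
          rw [this]; simp [Triv, alt1]

theorem XW_countable_sub (c : Bool × Bool) {α β : ℕ → Bool} (hα : α 0 = false) (hβ : β 0 = true)
    (h : (XW α β).Countable) : (XW (isub1 c α) (isub1 c β)).Countable := by
  refine (Ev_countable (Triv_countable.union (h.image (isub1 c)))).mono ?_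
  intro x hx
  rcases XW_red_aux c hα hβ hx with ⟨k, hk⟩ | ⟨k, z, hz⟩
  · exact ⟨k, Or.inl hk⟩
  · refine ⟨k, Or.inr ⟨z, ?_, hz.symm⟩⟩
    apply XW_of_isub1 c
    rw [← hz]
    exact XW_iter hx k

theorem XW_countable_zero (β : ℕ → Bool) : (XW (cst false) β).Countable := by
  refine (Ev_countable Triv_countable).mono ?_
  intro x hx
  by_cases hc : ∃ n, x n = false
  · obtain ⟨n, hn⟩ := hc
    refine ⟨n, ?_⟩
    have h := (hx n).1 hn
    have h' := cst_false_le (shft^[n] x)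
    rw [seqLe_iff] at h h'
    rw [toLex.injective (le_antisymm h h')]
    exact cst_mem_Triv _
  · push Not at hc
    refine ⟨0, ?_⟩
    have : x = cst true := by funext n; simpa [cst] using hc n
    simpa [this] using cst_mem_Triv true

theorem XW_countable_one (α : ℕ → Bool) : (XW α (cst true)).Countable := by
  refine (Ev_countable Triv_countable).mono ?_
  intro x hx
  by_cases hc : ∃ n, x n = true
  · obtain ⟨n, hn⟩ := hc
    refine ⟨n, ?_⟩
    have h := (hx n).2 hn
    have h' := le_cst_true (shft^[n] x)
    rw [seqLe_iff] at h h'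
    rw [toLex.injective (le_antisymm h' h)]
    exact cst_mem_Triv _
  · push Not at hc
    refine ⟨0, ?_⟩
    have : x = cst false := by funext n; simpa [cst] using hc n
    simpa [this] using cst_mem_Triv false

/-- Composite substitution on sequences. -/
def isub (l : List (Bool × Bool)) (x : ℕ → Bool) : ℕ → Bool := l.foldr isub1 x

/-- Composite substitution on words. -/
def lsub (l : List (Bool × Bool)) (w : List Bool) : List Bool := l.foldr lsub1 w

theorem isub_nil (x : ℕ → Bool) : isub [] x = x := rfl
theorem isub_cons (c) (l : List (Bool × Bool)) (x : ℕ → Bool) :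
    isub (c :: l) x = isub1 c (isub l x) := rfl
theorem isub_append (l l' : List (Bool × Bool)) (x : ℕ → Bool) :
    isub (l ++ l') x = isub l (isub l' x) := by simp [isub]
theorem lsub_append (l l' : List (Bool × Bool)) (x : List Bool) :
    lsub (l ++ l') x = lsub l (lsub l' x) := by simp [lsub]

theorem isub_head (l : List (Bool × Bool)) (x : ℕ → Bool) : isub l x 0 = x 0 := by
  induction l with
  | nil => rfl
  | cons c l ih => rw [isub_cons, isub1_head, ih]

theorem isub_lt (l : List (Bool × Bool)) {x y : ℕ → Bool} (h : seqLt x y) :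
    seqLt (isub l x) (isub l y) := by
  induction l with
  | nil => exact h
  | cons c l ih => exact isub1_lt c ih

theorem isub_inj (l : List (Bool × Bool)) : Function.Injective (isub l) := by
  induction l with
  | nil => exact fun x y h => h
  | cons c l ih => exact (isub1_inj c).comp ih

theorem isub_inf (l : List (Bool × Bool)) {b : Bool} {x : ℕ → Bool} (h : InfB b x) :
    InfB b (isub l x) := by
  induction l with
  | nil => exact h
  | cons c l ih => exact isub1_inf c ih

theorem isub_agree (l : List (Bool × Bool)) {n : ℕ} {x y : ℕ → Bool} (h : Agree n x y) :
    Agree n (isub l x) (isub l y) := by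
  induction l with
  | nil => exact h
  | cons c l ih => exact isub1_agree c ih

theorem isub_cat (l : List (Bool × Bool)) (w : List Bool) (x : ℕ → Bool) :
    isub l (cat w x) = cat (lsub l w) (isub l x) := by
  induction l with
  | nil => rfl
  | cons c l ih => rw [isub_cons, ih, isub1_cat]; rfl

theorem XS_isub (l : List (Bool × Bool)) (x : ℕ → Bool) :
    isub l x ∈ XS (isub l (cns false (cst true))) (isub l (cns true (cst false))) := by
  induction l with
  | nil =>
    intro n
    exact ⟨(seqLe_cns _ _ _).2 (le_cst_true _), (seqLe_cns _ _ _).2 (cst_false_le _)⟩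
  | cons c l ih => exact XS_sub c ih

theorem XW_countable_isub (l : List (Bool × Bool)) {α β : ℕ → Bool} (hα : α 0 = false) (hβ : β 0 = true)
    (h : (XW α β).Countable) : (XW (isub l α) (isub l β)).Countable := by
  induction l with
  | nil => exact h
  | cons c l ih =>
    exact XW_countable_sub c ((isub_head l α).trans hα) ((isub_head l β).trans hβ) ih

/-! ### From sequences to survivor sets -/

theorem Dbl_mem {x : ℝ} (hx : x ∈ Set.Icc (0:ℝ) 1) : Dbl x ∈ Set.Icc (0:ℝ) 1 := by
  obtain ⟨h0, h1⟩ := hx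
  unfold Dbl
  split_ifs with h
  · constructor <;> linarith
  · constructor <;> linarith

open Classical in
/-- Itinerary of a point. -/
def itin (x : ℝ) : ℕ → Bool := fun n => decide (1/2 < Dbl^[n] x)

theorem itin_shft (x : ℝ) : shft (itin x) = itin (Dbl x) := by
  funext n; simp [shft, itin]

theorem itin_eq (x : ℝ) : x = (bv (itin x 0) + Dbl x) / 2 := by
  unfold itin bv Dbl
  by_cases h : x ≤ 1/2
  · have h' : ¬ (1/2 < x) := not_lt.2 h
    simp only [Function.iterate_zero, id, h, h', decide_false, if_true]
    simp
  · have h' : 1/2 < x := not_le.1 h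
    simp only [Function.iterate_zero, id, h, h', decide_true, if_true, if_false]
    ring

theorem pi_itin {x : ℝ} (hx : x ∈ Set.Icc (0:ℝ) 1) : piMap (itin x) = x := by
  have key : ∀ n : ℕ, ∀ x ∈ Set.Icc (0:ℝ) 1, |piMap (itin x) - x| ≤ (1/2)^n := by
    intro n
    induction n with
    | zero =>
      intro x hx
      have := pi_nonneg (itin x); have := pi_le_one (itin x)
      rw [abs_le]; simp
      constructor <;> linarith [hx.1, hx.2]
    | succ n ih =>
      intro x hx
      have h := ih _ (Dbl_mem hx)
      have h1 : piMap (itin x) - x = (piMap (itin (Dbl x)) - Dbl x) * (1/2) := by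
        have e1 := itin_eq x
        have e2 := pi_eta (itin x)
        rw [itin_shft] at e2
        linarith
      rw [h1, abs_mul, abs_of_pos (by norm_num : (0:ℝ) < 1/2), pow_succ]
      gcongr
  by_contra hne
  have hpos : 0 < |piMap (itin x) - x| := abs_pos.2 (sub_ne_zero.2 hne)
  obtain ⟨k, hk⟩ := exists_pow_lt_of_lt_one hpos (by norm_num : (1/2:ℝ) < 1)
  exact absurd (key k x hx) (not_le.2 hk)

theorem itin_iter (x : ℝ) (n : ℕ) : shft^[n] (itin x) = itin (Dbl^[n] x) := by
  induction n generalizing x with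
  | zero => rfl
  | succ n ih => rw [Function.iterate_succ_apply, itin_shft, ih, Function.iterate_succ_apply]

theorem Dbl_iter_mem {x : ℝ} (hx : x ∈ Set.Icc (0:ℝ) 1) (n : ℕ) : Dbl^[n] x ∈ Set.Icc (0:ℝ) 1 := by
  induction n with
  | zero => exact hx
  | succ n ih => rw [Function.iterate_succ_apply']; exact Dbl_mem ih

theorem not_inf {b : Bool} {x : ℕ → Bool} (h : ¬ InfB b x) : x ∈ Ev Triv := by
  unfold InfB at h
  push Not at h
  obtain ⟨n, hn⟩ := h
  refine ⟨n, ?_⟩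
  have : shft^[n] x = cst (!b) := by
    funext k
    rw [shft_iter]
    have := hn (k+n) (by omega)
    cases b <;> simpa [cst] using this
  rw [this]; exact cst_mem_Triv _

theorem J_countable {α β : ℕ → Bool} {a b : ℝ} (hX : (XW α β).Countable) (ha : a ≤ piMap α)
    (hb : piMap β ≤ b) (ha2 : a ≤ 1/2) (hb2 : 1/2 < b) : (J a b).Countable := by
  refine ((hX.union (Ev_countable Triv_countable)).image piMap).mono ?_
  rintro x ⟨hx, hJ⟩
  refine ⟨itin x, ?_, pi_itin hx⟩
  by_cases h0 : InfB false (itin x)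
  swap
  · exact Or.inr (not_inf h0)
  by_cases h1 : InfB true (itin x)
  swap
  · exact Or.inr (not_inf h1)
  left
  intro n
  have hn := hJ n
  rw [← pi_itin (Dbl_iter_mem hx n), ← itin_iter] at hn
  have i0 := (InfB_iter n).2 h0
  have i1 := (InfB_iter n).2 h1
  have hh : shft^[n] (itin x) 0 = itin x n := by rw [shft_iter]; simp
  generalize shft^[n] (itin x) = y at *
  rw [← hh]
  constructor
  · intro hy
    rw [← not_seqLt]
    intro hlt
    have l1 := pi_strict_right hlt i1
    have l2 : piMap y ≤ 1/2 := by
      rw [pi_eta, hy]; have := pi_le_one (shft y); simp [bv]; linarith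
    exact hn ⟨by linarith, by linarith⟩
  · intro hy
    rw [← not_seqLt]
    intro hlt
    have l1 := pi_strict_left hlt i0
    have l2 : 1/2 < piMap y := by
      rw [pi_eta, hy]; have := pi_pos (InfB_shft.2 i1); simp [bv]; linarith
    exact hn ⟨by linarith, by linarith⟩

theorem Dbl_pi {w : ℕ → Bool} (h : InfB true w) : Dbl (piMap w) = piMap (shft w) := by
  have e := pi_eta w
  have h1 := pi_pos (InfB_shft.2 h)
  have h2 := pi_le_one (shft w)
  unfold Dbl
  cases hw : w 0 <;> rw [hw] at e <;> simp [bv] at e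
  · rw [if_pos (by linarith)]; linarith
  · rw [if_neg (by linarith)]; linarith

theorem Dbl_iter_pi {w : ℕ → Bool} (h : InfB true w) (n : ℕ) :
    Dbl^[n] (piMap w) = piMap (shft^[n] w) := by
  induction n with
  | zero => rfl
  | succ n ih =>
    rw [Function.iterate_succ_apply', ih, Dbl_pi ((InfB_iter n).2 h), Function.iterate_succ_apply']

theorem seq_not_countable : ¬ (Set.univ : Set (ℕ → Bool)).Countable := by
  have h2 : Cardinal.mk (ℕ → Bool) = Cardinal.continuum := by simp
  rw [Set.countable_univ_iff]
  intro h
  have : Cardinal.mk (ℕ → Bool) ≤ Cardinal.aleph0 := Cardinal.mk_le_aleph0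
  rw [h2] at this
  exact absurd this (not_le.2 Cardinal.aleph0_lt_continuum)

theorem J_uncountable (l : List (Bool × Bool)) {a b : ℝ}
    (ha : piMap (isub l (cns false (cst true))) ≤ a)
    (hb : b ≤ piMap (isub l (cns true (cst false)))) : ¬ (J a b).Countable := by
  intro hJ
  let G : Set (ℕ → Bool) := {z | InfB false z ∧ InfB true z}
  have hG : ¬ G.Countable := by
    intro hG
    apply seq_not_countable
    refine (hG.union (Ev_countable Triv_countable)).mono ?_
    intro x _
    by_cases h0 : InfB false x
    · by_cases h1 : InfB true x
      · exact Or.inl ⟨h0, h1⟩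
      · exact Or.inr (not_inf h1)
    · exact Or.inr (not_inf h0)
  apply hG
  have hinj : Set.InjOn (fun z => piMap (isub l z)) G := by
    intro z hz z' hz' h
    apply isub_inj l
    by_contra hne
    rcases lt_trichotomy (toLex (isub l z)) (toLex (isub l z')) with h1 | h1 | h1
    · exact absurd h (pi_strict_left h1 (isub_inf l hz.1)).ne
    · exact hne (toLex.injective h1)
    · exact absurd h (pi_strict_left h1 (isub_inf l hz'.1)).ne'
  refine Set.MapsTo.countable_of_injOn (t := J a b) ?_ hinj hJ
  intro z hz
  have i1 := isub_inf l hz.2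
  refine ⟨⟨pi_nonneg _, pi_le_one _⟩, fun n => ?_⟩
  rw [Dbl_iter_pi i1]
  have hS := XS_isub l z
  rintro ⟨h1, h2⟩
  have hS1 := hS (n+1)
  rw [Function.iterate_succ_apply'] at hS1
  have hc := cns_eta (shft^[n] (isub l z))
  cases h0 : shft^[n] (isub l z) 0 <;> rw [h0] at hc <;> rw [hc.symm] at h1 h2
  · have := pi_mono hS1.1
    linarith
  · have := pi_mono hS1.2
    linarith

theorem chi_le {a B : ℝ} (hB : 0 ≤ B) (h : ∀ b, B < b → (J a b).Countable) : chi a ≤ B := by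
  refine Real.sSup_le ?_ hB
  rintro b ⟨_, hb⟩
  by_contra hlt
  exact hb (h b (not_le.1 hlt))

theorem le_chi {a b : ℝ} (h1 : a < b) (h2 : b < 1) (h : ¬ (J a b).Countable) : b ≤ chi a := by
  refine le_csSup ⟨1, ?_⟩ ⟨⟨h1, h2⟩, h⟩
  rintro c ⟨hc, _⟩
  exact hc.2.le

/-! ### The plateau for an abstract composite substitution -/

theorem agree_iter_B (k : ℕ) (y : ℕ → Bool) :
    ∃ y', isub (List.replicate k (true, false)) (cns false y) = cat (false :: List.replicate k true) y' := by
  induction k with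
  | zero => exact ⟨y, by simp [isub_nil, cat_cons, cat_nil]⟩
  | succ k ih =>
    obtain ⟨y', hy⟩ := ih
    refine ⟨isub1 (true, false) y', ?_⟩
    rw [List.replicate_succ, isub_cons, hy, isub1_cat]
    congr 1
    have : ∀ k, lsub1 (true, false) (List.replicate k true) = List.replicate k true := by
      intro k
      induction k with
      | zero => rfl
      | succ k ih => rw [List.replicate_succ]; simp only [lsub1, List.flatMap_cons] at ih ⊢; rw [ih]; rfl
    have h2 := this k
    simp only [lsub1, List.flatMap_cons] at h2 ⊢
    rw [h2]; rfl

theorem agree_iter_A (k : ℕ) (y : ℕ → Bool) :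
    ∃ y', isub (List.replicate k (false, true)) (cns true y) = cat (true :: List.replicate k false) y' := by
  induction k with
  | zero => exact ⟨y, by simp [isub_nil, cat_cons, cat_nil]⟩
  | succ k ih =>
    obtain ⟨y', hy⟩ := ih
    refine ⟨isub1 (false, true) y', ?_⟩
    rw [List.replicate_succ, isub_cons, hy, isub1_cat]
    congr 1
    have : ∀ k, lsub1 (false, true) (List.replicate k false) = List.replicate k false := by
      intro k
      induction k with
      | zero => rfl
      | succ k ih => rw [List.replicate_succ]; simp only [lsub1, List.flatMap_cons] at ih ⊢; rw [ih]; rfl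
    have h2 := this k
    simp only [lsub1, List.flatMap_cons] at h2 ⊢
    rw [h2]; rfl

theorem cst_cat (b : Bool) (k : ℕ) : cat (List.replicate k b) (cst b) = cst b := by
  induction k with
  | zero => exact cat_nil _
  | succ k ih => rw [List.replicate_succ, cat_cons, ih, ← cst_eq]

theorem B_cst_true : isub1 (true, false) (cst true) = cst true := by
  obtain ⟨z, hz⟩ := decode (true, false) {cst true} (by
    rintro y rfl
    exact ⟨true, cst true, rfl, by simp [fe, cat_cons, cat_nil, ← cst_eq]⟩) (cst true) rfl
  have : z = cst true := by
    funext n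
    obtain ⟨k, _, hk⟩ := isub1_tail (true, false) z n
    have h := isub1_head (true, false) (shft^[n] z)
    rw [hk, ← hz, shft_iter, shft_iter] at h
    simpa [cst] using h.symm
  rw [this] at hz
  exact hz.symm

theorem A_cst_false : isub1 (false, true) (cst false) = cst false := by
  obtain ⟨z, hz⟩ := decode (false, true) {cst false} (by
    rintro y rfl
    exact ⟨false, cst false, rfl, by simp [fe, cat_cons, cat_nil, ← cst_eq]⟩) (cst false) rfl
  have : z = cst false := by
    funext n
    obtain ⟨k, _, hk⟩ := isub1_tail (false, true) z n
    have h := isub1_head (false, true) (shft^[n] z)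
    rw [hk, ← hz, shft_iter, shft_iter] at h
    simpa [cst] using h.symm
  rw [this] at hz
  exact hz.symm

theorem A_cst_true : isub1 (false, true) (cst true) = alt1 := by
  have hM : alt1 = isub1 (false, true) (cst true) := by
    obtain ⟨z, hz⟩ := decode (false, true) {alt1} (by
      rintro y rfl
      exact ⟨true, alt1, rfl, by simp [fe, cat_cons, cat_nil, ← alt1_eq]⟩) alt1 rfl
    have e : ∀ n, shft^[n] z 0 = true ∧ isub1 (false, true) (shft^[n] z) = alt1 := by
      intro n
      induction n with
      | zero =>
        refine ⟨?_, hz.symm⟩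
        have h := isub1_head (false, true) z
        rw [← hz, alt1_eq] at h
        exact h.symm
      | succ n ih =>
        have h1 : isub1 (false, true) (shft^[n+1] z) = alt1 := by
          have h2 := isub1_eta (false, true) (shft^[n] z)
          rw [ih.1, ih.2, ← Function.iterate_succ_apply' shft] at h2
          simp only [fe, if_true, cat_cons, cat_nil] at h2
          rw [alt1_eq] at h2
          exact (cns_inj (cns_inj h2)).symm
        refine ⟨?_, h1⟩
        have h := isub1_head (false, true) (shft^[n+1] z)
        rw [h1, alt1_eq] at h
        exact h.symm
    have : z = cst true := by
      funext n
      have := (e n).1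
      rw [shft_iter] at this
      simpa [cst] using this
    rw [this] at hz
    exact hz
  exact hM.symm

theorem cns_false_alt1 : cns false alt1 = alt0 := by
  refine alt_of_step ?_ ?_ ?_
  · conv_lhs => rw [alt0_eq]
    simp [alt0, isub1_head, cst]
  · simp [cns, alt0, isub1_head, cst]
  · have h2 : ∀ i, cns false alt1 (i+2) = cns false alt1 i := by
      intro i
      show alt1 (i+1) = _
      conv_lhs => rw [alt1_eq]
      cases i <;> rfl
    have h1 : cns false alt1 1 = true := by
      show alt1 0 = true
      rw [alt1_eq]; rfl
    have key : ∀ i, cns false alt1 (i+1) = !(cns false alt1 i) ∧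
        cns false alt1 (i+2) = !(cns false alt1 (i+1)) := by
      intro i
      induction i with
      | zero => exact ⟨by rw [h1]; rfl, by rw [h2]; show false = !(cns false alt1 1); rw [h1]; rfl⟩
      | succ i ih => exact ⟨ih.2, by rw [h2, h2, ih.1]⟩
    exact fun i => (key i).1

theorem iterB_01 (k : ℕ) : isub (List.replicate k (true, false)) (cns false (cst true)) = cns false (cst true) := by
  induction k with
  | zero => rfl
  | succ k ih =>
    rw [List.replicate_succ, isub_cons, ih, isub1_cns, B_cst_true]
    simp [fe, cat_cons, cat_nil, ← cst_eq]

theorem iterB_cns_true (k : ℕ) (y : ℕ → Bool) : isub (List.replicate k (true, false)) (cns true y)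
    = cns true (isub (List.replicate k (true, false)) y) := by
  induction k with
  | zero => rfl
  | succ k ih =>
    rw [List.replicate_succ, isub_cons, ih, isub1_cns]
    simp [fe, cat_cons, cat_nil, isub_cons]

theorem iterA_cst (k : ℕ) : isub (List.replicate k (false, true)) (cst false) = cst false := by
  induction k with
  | zero => rfl
  | succ k ih => rw [List.replicate_succ, isub_cons, ih, A_cst_false]

theorem iterA_10 (k : ℕ) : isub (List.replicate k (false, true)) (cns true (cst false)) = cns true (cst false) := by
  induction k with
  | zero => rfl
  | succ k ih =>
    rw [List.replicate_succ, isub_cons, ih, isub1_cns, A_cst_false]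
    simp [fe, cat_cons, cat_nil, ← cst_eq]

theorem iterA_cns_false (k : ℕ) (y : ℕ → Bool) : isub (List.replicate k (false, true)) (cns false y)
    = cns false (isub (List.replicate k (false, true)) y) := by
  induction k with
  | zero => rfl
  | succ k ih =>
    rw [List.replicate_succ, isub_cons, ih, isub1_cns]
    simp [fe, cat_cons, cat_nil, isub_cons]

theorem agree_A (k : ℕ) (y : ℕ → Bool) :
    Agree (k+1) (isub (List.replicate k (false, true)) (cns true y)) (cns true (cst false)) := by
  obtain ⟨y', hy⟩ := agree_iter_A k y
  have h := Agree_cat (true :: List.replicate k false) y' (cst false)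
  rw [← hy, cat_cons, cst_cat] at h
  simpa using h

theorem agree_B (k : ℕ) (y : ℕ → Bool) :
    Agree (k+1) (isub (List.replicate k (true, false)) (cns false y)) (cns false (cst true)) := by
  obtain ⟨y', hy⟩ := agree_iter_B k y
  have h := Agree_cat (false :: List.replicate k true) y' (cst true)
  rw [← hy, cat_cons, cst_cat] at h
  simpa using h

section Plateau
variable (l' : List (Bool × Bool))

/-- Auxiliary composite. -/
def Lam (k : ℕ) : List (Bool × Bool) := l' ++ ((false, true) :: List.replicate k (true, false))

theorem Lam_isub (k : ℕ) (x : ℕ → Bool) : isub (Lam l' k) x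
    = isub l' (isub1 (false, true) (isub (List.replicate k (true, false)) x)) := by
  rw [Lam, isub_append, isub_cons]

theorem l_isub (x : ℕ → Bool) : isub (l' ++ [(true, true)]) x = isub l' (isub1 (true, true) x) := by
  rw [isub_append]; rfl

theorem A_01 : isub1 (false, true) (cns false (cst true)) = alt0 := by
  rw [isub1_cns, A_cst_true]
  simp only [fe, Bool.false_eq_true, if_false, cat_cons, cat_nil]
  exact cns_false_alt1

theorem A_101 : isub1 (false, true) (cns true (cns false (cst true))) = cns true (cns false alt0) := by
  rw [isub1_cns, A_01]
  simp only [fe, if_true, cat_cons, cat_nil]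

theorem M_10 : isub1 (true, true) (cns true (cst false)) = cns true (cns false alt0) := by
  rw [isub1_cns]
  simp only [fe, if_true, cat_cons, cat_nil, alt0]

theorem Lam_01 (k : ℕ) : isub (Lam l' k) (cns false (cst true)) = isub (l' ++ [(true, true)]) (cst false) := by
  rw [Lam_isub, l_isub, iterB_01, A_01]; rfl

theorem Lam_101 (k : ℕ) : isub (Lam l' k) (cns true (cns false (cst true)))
    = isub (l' ++ [(true, true)]) (cns true (cst false)) := by
  rw [Lam_isub, l_isub, iterB_cns_true, iterB_01, A_101, M_10]

theorem Lam_agree0 (k : ℕ) : Agree k (isub (Lam l' k) (cst false))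
    (isub (l' ++ [(true, true)]) (cst false)) := by
  have h := agree_B k (cst false)
  rw [← Lam_01 l' k, Lam_isub, Lam_isub, iterB_01]
  rw [← cst_eq] at h
  exact isub_agree _ (isub1_agree _ (h.mono (by omega)))

theorem Lam_agree1 (k : ℕ) : Agree k (isub (Lam l' k) (cns true (cst false)))
    (isub (l' ++ [(true, true)]) (cns true (cst false))) := by
  have h := agree_B k (cst false)
  rw [← Lam_101 l' k, Lam_isub, Lam_isub, iterB_cns_true, iterB_cns_true, iterB_01]
  rw [← cst_eq] at h
  exact isub_agree _ (isub1_agree _ ((Agree_cns true h).mono (by omega)))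

theorem Lam_lt (k : ℕ) : piMap (isub (Lam l' k) (cns true (cst false)))
    < piMap (isub (l' ++ [(true, true)]) (cns true (cst false))) := by
  rw [← Lam_101 l' k]
  refine pi_strict_right (isub_lt _ ?_) (isub_inf _ ?_)
  · rw [seqLt_cns]
    refine ⟨1, fun i hi => ?_, ?_⟩
    · obtain rfl : i = 0 := by omega
      rfl
    · show false < true; decide
  · rw [InfB_cns, InfB_cns]; exact InfB_cst true

theorem half_lt {l : List (Bool × Bool)} {x : ℕ → Bool} {n : ℕ} (h0 : x 0 = true)
    (hx : isub l x (n+1) = true) : 1/2 < piMap (isub l x) := by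
  rw [pi_eta, isub_head, h0]
  have := pi_pos_of_mem (x := shft (isub l x)) (n := n) hx
  simp [bv]; linarith

theorem half_le {l : List (Bool × Bool)} {x : ℕ → Bool} (h0 : x 0 = true) :
    1/2 ≤ piMap (isub l x) := by
  rw [pi_eta, isub_head, h0]
  have := pi_nonneg (shft (isub l x))
  simp [bv]; linarith

theorem le_half {l : List (Bool × Bool)} {x : ℕ → Bool} (h0 : x 0 = false) :
    piMap (isub l x) ≤ 1/2 := by
  rw [pi_eta, isub_head, h0]
  have := pi_le_one (shft (isub l x))
  simp [bv]; linarith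

theorem ts_gt_half : 1/2 < piMap (isub (l' ++ [(true, true)]) (cns true (cst false))) :=
  lt_of_le_of_lt (half_le (l := Lam l' 0) rfl) (Lam_lt l' 0)

theorem isub_lt_one {l : List (Bool × Bool)} : piMap (isub l (cns true (cst false))) < 1 :=
  pi_lt_one (isub_inf l (InfB_cns.2 (InfB_cst false)))

theorem plateau_lower {a : ℝ} (h1 : piMap (isub (l' ++ [(true, true)]) (cst false)) ≤ a) (h2 : a ≤ 1/2) :
    piMap (isub (l' ++ [(true, true)]) (cns true (cst false))) ≤ chi a := by
  refine le_of_forall_lt fun c hc => ?_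
  have hm : max c a < piMap (isub (l' ++ [(true, true)]) (cns true (cst false))) :=
    max_lt hc (lt_of_le_of_lt h2 (ts_gt_half l'))
  obtain ⟨k, hk⟩ := exists_close (Lam_agree1 l') (sub_pos.2 hm)
  have hk' := (abs_lt.1 hk).1
  have hb : max c a < piMap (isub (Lam l' k) (cns true (cst false))) := by linarith
  have hle := le_chi (lt_of_le_of_lt (le_max_right c a) hb) isub_lt_one
    (J_uncountable (Lam l' k) (a := a) (by rw [Lam_01]; exact h1) le_rfl)
  exact lt_of_lt_of_le (lt_of_le_of_lt (le_max_left c a) hb) hle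

theorem plateau_upper {a : ℝ} (l : List (Bool × Bool)) (hl : l = l' ++ [(true, true)])
    (h : a ≤ piMap (isub l (cns false (cns true (cst false))))) :
    chi a ≤ piMap (isub l (cns true (cst false))) := by
  refine chi_le (pi_nonneg _) fun b hb => ?_
  have hag : ∀ k, Agree k (isub (l ++ List.replicate k (false, true)) (cst true))
      (isub l (cns true (cst false))) := by
    intro k
    have h := agree_A k (cst true)
    rw [← cst_eq] at h
    rw [isub_append]
    exact isub_agree _ (h.mono (by omega))
  obtain ⟨k, hk⟩ := exists_close hag (sub_pos.2 hb)
  have hk' := (abs_lt.1 hk).2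
  have hc := XW_countable_isub (l ++ List.replicate k (false, true))
    (α := cns false (cns true (cst false))) (β := cst true) rfl rfl (XW_countable_one _)
  have e : isub (l ++ List.replicate k (false, true)) (cns false (cns true (cst false)))
      = isub l (cns false (cns true (cst false))) := by
    rw [isub_append, iterA_cns_false, iterA_10]
  rw [e] at hc
  refine J_countable hc h (by linarith) (h.trans (le_half rfl)) ?_
  have := ts_gt_half l'
  rw [← hl] at this
  linarith

theorem plateau_left {a : ℝ} (h : a < piMap (isub (l' ++ [(true, true)]) (cst false))) :
    chi a < piMap (isub (l' ++ [(true, true)]) (cns true (cst false))) := by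
  obtain ⟨k, hk⟩ := exists_close (Lam_agree0 l') (sub_pos.2 h)
  have hk' := (abs_lt.1 hk).1
  refine lt_of_le_of_lt ?_ (Lam_lt l' k)
  refine chi_le (pi_nonneg _) fun b hb => ?_
  have hc := XW_countable_isub (Lam l' k)
    (α := cst false) (β := cns true (cst false)) rfl rfl (XW_countable_zero _)
  refine J_countable hc (by linarith) hb.le (h.le.trans (le_half rfl)) ?_
  exact lt_of_le_of_lt (half_le rfl) hb

theorem plateau_right {a : ℝ} (l : List (Bool × Bool))
    (h : piMap (isub l (cns false (cns true (cst false)))) < a) (h2 : a < 1/2) :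
    piMap (isub l (cns true (cst false))) < chi a := by
  have hag : ∀ k, Agree k (isub (l ++ List.replicate k (false, true) ++ [(true, false)]) (cns false (cst true)))
      (isub l (cns false (cns true (cst false)))) := by
    intro k
    have h := agree_A k (cst true)
    have e := iterB_01 1
    rw [isub_append, isub_append]
    rw [show [(true, false)] = List.replicate 1 (true, false) from rfl, e, iterA_cns_false, cst_eq true]
    exact isub_agree _ ((Agree_cns false h).mono (by omega))
  obtain ⟨k, hk⟩ := exists_close hag (sub_pos.2 h)
  have hk' := (abs_lt.1 hk).2
  have hJ := J_uncountable (l ++ List.replicate k (false, true) ++ [(true, false)]) (a := a)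
    (by linarith) le_rfl
  refine lt_of_lt_of_le ?_ (le_chi (lt_of_lt_of_le h2 (half_le rfl)) isub_lt_one hJ)
  rw [isub_append, isub_append]
  have e : isub l (cns true (cst false))
      = isub l (isub (List.replicate k (false, true)) (cns true (cst false))) := by
    rw [iterA_10]
  rw [e, ← isub_append, ← isub_append]
  refine pi_strict_left (isub_lt _ ?_) (isub_inf _ (InfB_cns.2 (InfB_cst false)))
  have e2 : isub [(true, false)] (cns true (cst false))
      = cns true (cns false (cns true (isub1 (true, false) (cst false)))) := by
    rw [isub_cons, isub_nil, isub1_cns]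
    conv_lhs => rw [cst_eq, isub1_cns]
    simp [fe, cat_cons, cat_nil]
  rw [e2, seqLt_cns]
  refine ⟨1, fun i hi => ?_, ?_⟩
  · obtain rfl : i = 0 := by omega
    rfl
  · show false < true; decide

end Plateau


/-! ### Balanced words as codings of rotations -/

/-- `Run p z e w f`: the word `w` codes a path of the rotation from `e` to `f`. -/
def Run (p z : ℕ) : ℕ → List Bool → ℕ → Prop
  | e, [], f => e = f
  | e, b :: w, f => (e < p ∧ b = true ∧ Run p z (e + z) w f) ∨
      (p ≤ e ∧ b = false ∧ Run p z (e - p) w f)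

theorem run_append {p z : ℕ} {u v : List Bool} {e f : ℕ} :
    Run p z e (u ++ v) f ↔ ∃ g, Run p z e u g ∧ Run p z g v f := by
  induction u generalizing e with
  | nil => simp [Run]
  | cons b u ih =>
    simp only [List.cons_append, Run, ih]
    constructor
    · rintro (⟨h1, h2, g, h3, h4⟩ | ⟨h1, h2, g, h3, h4⟩)
      · exact ⟨g, Or.inl ⟨h1, h2, h3⟩, h4⟩
      · exact ⟨g, Or.inr ⟨h1, h2, h3⟩, h4⟩
    · rintro ⟨g, ⟨h1, h2, h3⟩ | ⟨h1, h2, h3⟩, h4⟩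
      · exact Or.inl ⟨h1, h2, g, h3, h4⟩
      · exact Or.inr ⟨h1, h2, g, h3, h4⟩

theorem run_lt {p z : ℕ} {w : List Bool} {e f : ℕ} (h : Run p z e w f) (he : e < p + z) :
    f < p + z := by
  induction w generalizing e with
  | nil => simp only [Run] at h; omega
  | cons b w ih =>
    rcases h with ⟨h1, _, h3⟩ | ⟨h1, _, h3⟩
    · exact ih h3 (by omega)
    · exact ih h3 (by omega)

theorem run_count {p z : ℕ} {w : List Bool} {e f : ℕ} (h : Run p z e w f) :
    (f : ℤ) = e + (p + z) * (w.count true : ℤ) - p * (w.length : ℤ) := by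
  induction w generalizing e with
  | nil => simp only [Run] at h; simp [h]
  | cons b w ih =>
    rcases h with ⟨h1, rfl, h3⟩ | ⟨h1, rfl, h3⟩
    · rw [ih h3]; simp; ring
    · rw [ih h3]; simp [Nat.cast_sub h1]; ring

theorem run_lex {p z : ℕ} {w w' : List Bool} {e f e' f' : ℕ} (h : Run p z e w f)
    (h' : Run p z e' w' f') (hl : w.length = w'.length) (he : e ≤ e') :
    w' = w ∨ List.Lex (· < ·) w' w := by
  induction w generalizing e e' w' with
  | nil =>
    left; symm at hl; simpa using hl
  | cons b w ih =>
    rcases w' with _ | ⟨b', w'⟩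
    · simp at hl
    · simp only [List.length_cons, Nat.add_right_cancel_iff] at hl
      rcases h with ⟨h1, rfl, h3⟩ | ⟨h1, rfl, h3⟩ <;>
        rcases h' with ⟨h1', rfl, h3'⟩ | ⟨h1', rfl, h3'⟩
      · rcases ih h3 h3' hl (by omega) with h | h
        · exact Or.inl (by rw [h])
        · exact Or.inr (List.Lex.cons h)
      · exact Or.inr (List.Lex.rel (by decide))
      · omega
      · rcases ih h3 h3' hl (by omega) with h | h
        · exact Or.inl (by rw [h])
        · exact Or.inr (List.Lex.cons h)

theorem run_balanced {p z : ℕ} {w : List Bool} {e : ℕ} (h : Run p z e w e) (he : e < p + z) :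
    CycBalanced w := by
  have hw : Run p z e (w ++ w) e := run_append.2 ⟨e, h, h⟩
  have key : ∀ u : List Bool, u <:+: w ++ w → ∃ f g, Run p z f u g ∧ f < p + z ∧ g < p + z := by
    rintro u ⟨s, t, hst⟩
    rw [← hst] at hw
    obtain ⟨g, h1, h2⟩ := run_append.1 hw
    obtain ⟨f, h3, h4⟩ := run_append.1 h1
    exact ⟨f, g, h4, run_lt h3 he, run_lt h1 he⟩
  intro u v hu hv huv
  obtain ⟨f, g, h1, h2, h3⟩ := key u hu
  obtain ⟨f', g', h1', h2', h3'⟩ := key v hv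
  have c := run_count h1
  have c' := run_count h1'
  rw [huv] at c
  by_contra hcon
  have : (2 : ℤ) ≤ (u.count true : ℤ) - (v.count true : ℤ) := by omega
  have h4 : ((p : ℤ) + z) * 2 ≤ (p + z) * ((u.count true : ℤ) - (v.count true : ℤ)) :=
    mul_le_mul_of_nonneg_left this (by positivity)
  rw [mul_sub] at h4
  omega

theorem run_of_bound {p z : ℕ} {w : List Bool} {e : ℕ}
    (h : ∀ k ≤ w.length, 0 ≤ (e : ℤ) + (p + z) * ((w.take k).count true : ℤ) - p * k ∧
      (e : ℤ) + (p + z) * ((w.take k).count true : ℤ) - p * k < p + z) :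
    ∃ f, Run p z e w f := by
  induction w generalizing e with
  | nil => exact ⟨e, rfl⟩
  | cons b w ih =>
    have h1 := h 1 (by simp)
    cases b
    · simp at h1
      have hpe : p ≤ e := by omega
      obtain ⟨f, hf⟩ := ih (e := e - p) (by
        intro k hk
        have := h (k+1) (by simpa using hk)
        simp [mul_add] at this
        push_cast [hpe]
        constructor <;> linarith [this.1, this.2])
      exact ⟨f, Or.inr ⟨hpe, rfl, hf⟩⟩
    · simp at h1
      have hpe : e < p := by omega
      obtain ⟨f, hf⟩ := ih (e := e + z) (by
        intro k hk
        have := h (k+1) (by simpa using hk)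
        simp [mul_add] at this
        push_cast
        constructor <;> linarith [this.1, this.2])
      exact ⟨f, Or.inl ⟨hpe, rfl, hf⟩⟩

/-- Number of ones in the prefix of length `k` of `ww`. -/
def Cn (w : List Bool) (k : ℕ) : ℤ := ((w ++ w).take k).count true

theorem Cn_add (w : List Bool) (i l : ℕ) :
    Cn w (i + l) = Cn w i + ((((w ++ w).drop i).take l).count true : ℤ) := by
  unfold Cn
  rw [List.take_add, List.count_append]; push_cast; rfl

theorem Cn_period (w : List Bool) {k : ℕ} (hk : k ≤ w.length) :
    Cn w (k + w.length) = Cn w k + w.count true := by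
  unfold Cn
  rw [add_comm k, List.take_length_add_append, List.count_append, List.take_append_of_le_length hk]
  push_cast; ring

theorem Cn_bal {w : List Bool} (hw : CycBalanced w) {i j l : ℕ} (hi : i + l ≤ 2 * w.length)
    (hj : j + l ≤ 2 * w.length) : (Cn w (i + l) - Cn w i) - (Cn w (j + l) - Cn w j) ≤ 1 := by
  rw [Cn_add, Cn_add]
  have := hw (((w ++ w).drop i).take l) (((w ++ w).drop j).take l)
    ((List.take_prefix _ _).isInfix.trans (List.drop_suffix _ _).isInfix)
    ((List.take_prefix _ _).isInfix.trans (List.drop_suffix _ _).isInfix)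
    (by simp; omega)
  linarith

theorem Cn_sum (w : List Bool) {l : ℕ} (hl : l ≤ w.length) :
    ∑ i ∈ Finset.range w.length, (Cn w (i + l) - Cn w i) = l * w.count true := by
  induction l with
  | zero => simp
  | succ l ih =>
    have h1 := ih (by omega)
    have h2 : ∑ i ∈ Finset.range w.length, (Cn w (i + 1 + l) - Cn w (i + l)) = w.count true := by
      rw [Finset.sum_range_sub (fun i => Cn w (i + l))]
      have := Cn_period w (k := l) (by omega)
      rw [add_comm w.length, this]; simp
    have h3 : ∑ i ∈ Finset.range w.length, (Cn w (i + (l + 1)) - Cn w i)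
        = ∑ i ∈ Finset.range w.length, (Cn w (i + l) - Cn w i)
          + ∑ i ∈ Finset.range w.length, (Cn w (i + 1 + l) - Cn w (i + l)) := by
      rw [← Finset.sum_add_distrib]
      apply Finset.sum_congr rfl
      intro i _
      rw [show i + (l + 1) = i + 1 + l by ring]; ring
    rw [h3, h1, h2]; push_cast; ring

theorem Cn_close {w : List Bool} (hw : CycBalanced w) {i l : ℕ} (hi : i < w.length)
    (hl : l ≤ w.length) :
    |(w.length : ℤ) * (Cn w (i + l) - Cn w i) - l * w.count true| < w.length := by
  rw [← Cn_sum w hl]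
  have h1 : (w.length : ℤ) * (Cn w (i + l) - Cn w i)
      = ∑ _j ∈ Finset.range w.length, (Cn w (i + l) - Cn w i) := by
    rw [Finset.sum_const, Finset.card_range, nsmul_eq_mul]
  rw [h1, ← Finset.sum_sub_distrib]
  refine (Finset.abs_sum_le_sum_abs _ _).trans_lt ?_
  have h2 : (w.length : ℤ) = ∑ _j ∈ Finset.range w.length, (1 : ℤ) := by simp
  rw [h2]
  apply Finset.sum_lt_sum
  · intro j hj
    have hj' := Finset.mem_range.1 hj
    rw [abs_le]
    have a1 := Cn_bal hw (i := i) (j := j) (l := l) (by omega) (by omega)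
    have a2 := Cn_bal hw (i := j) (j := i) (l := l) (by omega) (by omega)
    constructor <;> linarith
  · exact ⟨i, Finset.mem_range.2 hi, by simp⟩

theorem balanced_run {p z : ℕ} {w : List Bool} (hp : 1 ≤ p) (hw : CycBalanced w) (hlen : w.length = p + z)
    (hc : w.count true = p) : ∃ e < p + z, Run p z e w e := by
  set d : ℕ → ℤ := fun k => (p + z) * Cn w k - p * k with hd
  have hclose : ∀ i j, i ≤ j → j ≤ w.length → |d j - d i| < p + z ∨ i = j := by
    intro i j hij hj
    rcases hij.eq_or_lt with h | h
    · exact Or.inr h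
    · left
      have := Cn_close hw (i := i) (l := j - i) (by omega) (by omega)
      rw [show i + (j - i) = j by omega, hlen, hc, Nat.cast_sub hij] at this
      push_cast at this
      rw [hd]
      convert this using 2
      ring
  obtain ⟨i0, hi0, hmin⟩ := Finset.exists_min_image (Finset.range (w.length + 1)) d ⟨0, by simp⟩
  have hi0' : i0 ≤ w.length := by simpa [Nat.lt_succ_iff] using hi0
  have d0 : d 0 = 0 := by simp [hd, Cn]
  have hm0 : d i0 ≤ 0 := d0 ▸ hmin 0 (by simp)
  obtain ⟨e, he⟩ := Int.eq_ofNat_of_zero_le (a := - d i0) (by linarith)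
  have hall : ∀ k ≤ w.length, 0 ≤ (e : ℤ) + d k ∧ (e : ℤ) + d k < p + z := by
    intro k hk
    rw [← he]
    refine ⟨by linarith [hmin k (by simpa [Nat.lt_succ_iff] using hk)], ?_⟩
    rcases le_total i0 k with h | h
    · rcases hclose i0 k h hk with h | h
      · linarith [le_abs_self (d k - d i0)]
      · subst h; omega
    · rcases hclose k i0 h hi0' with h | h
      · linarith [neg_abs_le (d i0 - d k)]
      · subst h; omega
  have he' : e < p + z := by
    have := (hall 0 (by omega)).2
    rw [d0] at this; omega
  obtain ⟨f, hf⟩ := run_of_bound (p := p) (z := z) (w := w) (e := e) (by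
    intro k hk
    have := hall k hk
    simp only [hd, Cn, List.take_append_of_le_length hk] at this
    constructor <;> linarith [this.1, this.2])
  have hfe : f = e := by
    have := run_count hf
    rw [hc, hlen] at this
    push_cast at this
    have h2 : (f : ℤ) = e := by rw [this]; ring
    exact_mod_cast h2
  exact ⟨e, he', hfe ▸ hf⟩

theorem run_liftA {p z : ℕ} (hpz : p < z) {w : List Bool} {e f : ℕ}
    (h : Run p (z - p) e w f) : Run p z e (lsub1 (false, true) w) f := by
  induction w generalizing e with
  | nil => exact h
  | cons b w ih =>
    rcases h with ⟨h1, rfl, h3⟩ | ⟨h1, rfl, h3⟩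
    · refine Or.inl ⟨h1, rfl, Or.inr ⟨by omega, rfl, ?_⟩⟩
      have := ih h3
      rwa [show e + (z - p) = e + z - p by omega] at this
    · exact Or.inr ⟨h1, rfl, ih h3⟩

theorem run_liftB {p z : ℕ} (hpz : z < p) {w : List Bool} {e f : ℕ} (he : e < p)
    (h : Run (p - z) z e w f) : Run p z (e + z) (lsub1 (true, false) w) (f + z) := by
  induction w generalizing e with
  | nil => simp only [Run] at h; subst h; rfl
  | cons b w ih =>
    rcases h with ⟨h1, rfl, h3⟩ | ⟨h1, rfl, h3⟩
    · exact Or.inl ⟨by omega, rfl, ih (by omega) h3⟩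
    · refine Or.inr ⟨by omega, rfl, Or.inl ⟨by omega, rfl, ?_⟩⟩
      have := ih (by omega) h3
      rwa [show e - (p - z) + z = e + z - p + z by omega] at this

theorem count_liftA (w : List Bool) : (lsub1 (false, true) w).count true = w.count true ∧
    (lsub1 (false, true) w).length = w.length + w.count true := by
  induction w with
  | nil => simp [lsub1]
  | cons b w ih =>
    have : lsub1 (false, true) (b :: w) = fe (false, true) b ++ lsub1 (false, true) w := rfl
    rw [this]
    cases b <;> simp [fe, ih] <;> omega

theorem count_liftB (w : List Bool) : (lsub1 (true, false) w).count true = w.length ∧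
    (lsub1 (true, false) w).length + w.count true = 2 * w.length := by
  induction w with
  | nil => simp [lsub1]
  | cons b w ih =>
    have : lsub1 (true, false) (b :: w) = fe (true, false) b ++ lsub1 (true, false) w := rfl
    rw [this]
    cases b <;> simp [fe, ih] <;> omega

theorem exists_tau (n : ℕ) : ∀ p z : ℕ, p + z ≤ n → 1 ≤ p → 1 ≤ z → Nat.Coprime p z →
    ∃ τ : List (Bool × Bool),
      (Run p z p (lsub τ [false, true]) p ∧ (lsub τ [false, true]).count true = p ∧
        (lsub τ [false, true]).length = p + z) ∧
      (Run p z (p - 1) (lsub τ [true, false]) (p - 1) ∧ (lsub τ [true, false]).count true = p ∧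
        (lsub τ [true, false]).length = p + z) := by
  induction n with
  | zero => intro p z h h1 h2; omega
  | succ n ih =>
    intro p z h h1 h2 hc
    rcases lt_trichotomy p z with hpz | rfl | hpz
    · obtain ⟨τ, ⟨a1, a2, a3⟩, b1, b2, b3⟩ := ih p (z - p) (by omega) h1 (by omega)
        ((Nat.coprime_sub_self_right hpz.le).2 hc)
      refine ⟨(false, true) :: τ, ⟨run_liftA hpz a1, (count_liftA _).1.trans a2, ?_⟩,
        run_liftA hpz b1, (count_liftA _).1.trans b2, ?_⟩
      · refine (count_liftA _).2.trans ?_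
        change (lsub τ _).length + (lsub τ _).count true = _
        omega
      · refine (count_liftA _).2.trans ?_
        change (lsub τ _).length + (lsub τ _).count true = _
        omega
    · have : p = 1 := by simpa using hc
      subst this
      refine ⟨[], ⟨?_, rfl, rfl⟩, ?_, rfl, rfl⟩
      · simp [lsub, Run]
      · simp [lsub, Run]
    · obtain ⟨τ, ⟨a1, a2, a3⟩, b1, b2, b3⟩ := ih (p - z) z (by omega) (by omega) (by omega)
        ((Nat.coprime_sub_self_left hpz.le).2 hc)
      refine ⟨(true, false) :: τ, ⟨?_, ?_, ?_⟩, ?_, ?_, ?_⟩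
      · have := run_liftB hpz (by omega) a1
        rwa [Nat.sub_add_cancel hpz.le] at this
      · refine (count_liftB _).1.trans ?_
        change (lsub τ _).length = _
        omega
      · have := (count_liftB (lsub τ [false, true])).2
        change (lsub1 _ (lsub τ _)).length = _
        omega
      · have := run_liftB hpz (by omega) b1
        rwa [show p - z - 1 + z = p - 1 by omega] at this
      · refine (count_liftB _).1.trans ?_
        change (lsub τ _).length = _
        omega
      · have := (count_liftB (lsub τ [true, false])).2
        change (lsub1 _ (lsub τ _)).length = _
        omega

theorem lex_asymm {u v : List Bool} (h : List.Lex (· < ·) u v) (h' : List.Lex (· < ·) v u) :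
    False := by
  have a : u < v := h
  have b : v < u := h'
  exact lt_asymm a b

theorem omegaMinus_eq {r : ℚ} {w : List Bool} (h : IsOmegaMinus r w) : omegaMinus r = w := by
  have hex : ∃ w, IsOmegaMinus r w := ⟨w, h⟩
  have hs := hex.choose_spec
  rw [omegaMinus, dif_pos hex]
  rcases h.2 _ hs.1 with e | e
  · exact e
  · rcases hs.2 _ h.1 with e' | e'
    · exact e'.symm
    · exact (lex_asymm e e').elim

theorem omegaPlus_eq {r : ℚ} {w : List Bool} (h : IsOmegaPlus r w) : omegaPlus r = w := by
  have hex : ∃ w, IsOmegaPlus r w := ⟨w, h⟩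
  have hs := hex.choose_spec
  rw [omegaPlus, dif_pos hex]
  rcases h.2 _ hs.1 with e | e
  · exact e
  · rcases hs.2 _ h.1 with e' | e'
    · exact e'.symm
    · exact (lex_asymm e e').elim

theorem run_head {p z e f : ℕ} {w : List Bool} {b : Bool} (h : Run p z e w f)
    (hb : w.head? = some b) : (b = true ∧ e < p) ∨ (b = false ∧ p ≤ e) := by
  rcases w with _ | ⟨c, w⟩
  · simp at hb
  · simp only [List.head?_cons, Option.some.injEq] at hb
    subst hb
    rcases h with ⟨h1, h2, _⟩ | ⟨h1, h2, _⟩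
    · exact Or.inl ⟨h2, h1⟩
    · exact Or.inr ⟨h2, h1⟩

theorem head_of_run {p z e f : ℕ} {w : List Bool} (h : Run p z e w f) (hw : 0 < w.length) :
    w.head? = some (decide (e < p)) := by
  rcases w with _ | ⟨c, w⟩
  · simp at hw
  · rcases h with ⟨h1, rfl, _⟩ | ⟨h1, rfl, _⟩
    · simp [h1]
    · simp [h1]

theorem omega_tau {r : ℚ} (h0 : 0 < r) (h1 : r < 1) : ∃ τ : List (Bool × Bool),
    omegaMinus r = lsub τ [false, true] ∧ omegaPlus r = lsub τ [true, false] := by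
  have hp : 0 < r.num := Rat.num_pos.2 h0
  have hlt : r.num < r.den := by
    have h := Rat.lt_iff r 1 |>.1 h1
    simpa using h
  obtain ⟨p, hpe⟩ := Int.eq_ofNat_of_zero_le hp.le
  obtain ⟨z, hz⟩ : ∃ z, r.den = p + z := ⟨r.den - p, by omega⟩
  have hp1 : 1 ≤ p := by omega
  have hz1 : 1 ≤ z := by omega
  have hpn : r.num.toNat = p := by rw [hpe]; rfl
  have hcop : Nat.Coprime p z := by
    have := r.reduced
    rw [hpe, hz] at this
    simpa using this
  obtain ⟨τ, ⟨a1, a2, a3⟩, b1, b2, b3⟩ := exists_tau (p + z) p z le_rfl hp1 hz1 hcop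
  refine ⟨τ, omegaMinus_eq ⟨⟨?_, ?_, ?_, ?_⟩, ?_⟩, omegaPlus_eq ⟨⟨?_, ?_, ?_, ?_⟩, ?_⟩⟩
  · rw [a3, hz]
  · rw [a2, hpn]
  · exact run_balanced a1 (by omega)
  · rw [head_of_run a1 (by omega)]; simp
  · rintro v ⟨v1, v2, v3, v4⟩
    rw [hz] at v1; rw [hpn] at v2
    obtain ⟨e, _, hr⟩ := balanced_run hp1 v3 v1 v2
    rcases run_head hr v4 with ⟨h, _⟩ | ⟨_, h⟩
    · cases h
    · exact run_lex a1 hr (by omega) h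
  · rw [b3, hz]
  · rw [b2, hpn]
  · exact run_balanced b1 (by omega)
  · rw [head_of_run b1 (by omega)]; simp; omega
  · rintro v ⟨v1, v2, v3, v4⟩
    rw [hz] at v1; rw [hpn] at v2
    obtain ⟨e, _, hr⟩ := balanced_run hp1 v3 v1 v2
    rcases run_head hr v4 with ⟨_, h⟩ | ⟨h, _⟩
    · rcases run_lex hr b1 (by omega) (by omega) with h | h
      · exact Or.inl h.symm
      · exact Or.inr h
    · cases h

/-! ### Assembly -/

theorem lsub_nil_word (l : List (Bool × Bool)) : lsub l [] = [] := by
  induction l with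
  | nil => rfl
  | cons c l ih =>
    change lsub1 c (lsub l []) = []
    rw [ih]; rfl

theorem lsub_word_append (l : List (Bool × Bool)) (u v : List Bool) :
    lsub l (u ++ v) = lsub l u ++ lsub l v := by
  induction l with
  | nil => rfl
  | cons c l ih =>
    change lsub1 c (lsub l (u ++ v)) = lsub1 c (lsub l u) ++ lsub1 c (lsub l v)
    rw [ih]; simp [lsub1]

theorem lsub_length (l : List (Bool × Bool)) (w : List Bool) : w.length ≤ (lsub l w).length := by
  induction l with
  | nil => exact le_rfl
  | cons c l ih => exact ih.trans (lsub1_length c _)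

theorem substR_eq {r : ℚ} {τ : List (Bool × Bool)} (h1 : omegaMinus r = lsub τ [false, true])
    (h2 : omegaPlus r = lsub τ [true, false]) (w : List Bool) :
    substR r w = lsub (τ ++ [(true, true)]) w := by
  rw [lsub_append]
  induction w with
  | nil => exact (lsub_nil_word τ).symm
  | cons b w ih =>
    have e1 : substR r (b :: w) = (if b then omegaPlus r else omegaMinus r) ++ substR r w := rfl
    have e2 : lsub [(true, true)] (b :: w) = fe (true, true) b ++ lsub [(true, true)] w := rfl
    rw [e1, e2, ih, lsub_word_append]
    cases b
    · simp [fe, h1]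
    · simp [fe, h2]

theorem words_eq (rs : List ℚ) (hne : 1 ≤ rs.length) (hrs : ∀ r ∈ rs, 0 < r ∧ r < 1) :
    ∃ l' : List (Bool × Bool), sWord rs = lsub (l' ++ [(true, true)]) [false] ∧
      tWord rs = lsub (l' ++ [(true, true)]) [true] := by
  induction rs with
  | nil => simp at hne
  | cons r rs ih =>
    obtain ⟨h0, h1⟩ := hrs r (by simp)
    obtain ⟨τ, t1, t2⟩ := omega_tau h0 h1
    rcases rs with _ | ⟨r', rs⟩
    · exact ⟨τ, substR_eq t1 t2 _, substR_eq t1 t2 _⟩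
    · obtain ⟨l', a, b⟩ := ih (by simp) (fun x hx => hrs x (List.mem_cons_of_mem _ hx))
      refine ⟨τ ++ [(true, true)] ++ l', ?_, ?_⟩
      · rw [sWord, a, substR_eq t1 t2, List.append_assoc (τ ++ _), lsub_append (τ ++ _)]
      · rw [tWord, b, substR_eq t1 t2, List.append_assoc (τ ++ _), lsub_append (τ ++ _)]

theorem per_unique {w : List Bool} {y : ℕ → Bool} (hw : 1 ≤ w.length) (hy : y = cat w y) :
    per w = y := by
  funext n
  induction n using Nat.strong_induction_on with
  | _ n ih =>
    rw [hy]
    by_cases hn : n < w.length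
    · simp only [cat, per, if_pos hn, Nat.mod_eq_of_lt hn]
    · simp only [cat, if_neg hn]
      rw [← ih _ (by omega)]
      simp only [per]
      rw [Nat.mod_eq_sub_mod (by omega)]

theorem cat_lsub_single (l : List (Bool × Bool)) (b : Bool) (x : ℕ → Bool) :
    cat (lsub l [b]) (isub l x) = isub l (cns b x) := by
  rw [← isub_cat, cat_cons, cat_nil]

theorem per_lsub (l : List (Bool × Bool)) : per (lsub l [false]) = isub l (cst false) := by
  apply per_unique
  · exact lsub_length l [false]
  · rw [cat_lsub_single, ← cst_eq]

theorem stmt11 (rs : List ℚ) (hne : 1 ≤ rs.length) (hrs : ∀ r ∈ rs, 0 < r ∧ r < 1) :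
    (∀ a ∈ Set.Icc (piMap (per (sWord rs)))
        (piMap (cat (sWord rs) (cat (tWord rs) (per (sWord rs))))),
      chi a = piMap (cat (tWord rs) (per (sWord rs)))) ∧
    (∀ a ∈ Set.Ioo (1/4 : ℝ) (piMap (per (sWord rs))),
      chi a < piMap (cat (tWord rs) (per (sWord rs)))) ∧
    (∀ a ∈ Set.Ioo (piMap (cat (sWord rs) (cat (tWord rs) (per (sWord rs))))) (1/2 : ℝ),
      chi a > piMap (cat (tWord rs) (per (sWord rs)))) := by

  obtain ⟨l', hs, ht⟩ := words_eq rs hne hrs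
  rw [hs, ht, per_lsub, cat_lsub_single, cat_lsub_single]
  refine ⟨fun a ha => ?_, fun a ha => ?_, fun a ha => ?_⟩
  · exact le_antisymm (plateau_upper l' _ rfl ha.2)
      (plateau_lower l' ha.1 (ha.2.trans (le_half rfl)))
  · exact plateau_left l' ha.2
  · exact plateau_right _ ha.1 ha.2

end
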